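/- Let 𝔑_g denote the set of all local good semigroups of ℕ² with genus g. Define A₁ = {ℕ²(1,1)} and, for i ≥ 2, A_i = {S' : S' is a special son of some S ∈ A_{i−1}}. Then A_g = 𝔑_g for all g ∈ ℕ∖{0}. -/

import Mathlib

/-- The ambient space `ℤ²`; `ℕ²` is identified with the nonnegative orthant. -/
abbrev Z2 : Type := ℤ × ℤ

/-- The nonnegative orthant, representing `ℕ² ⊆ ℤ²`. -/
def orth : Set Z2 := {a : Z2 | 0 ≤ a.1 ∧ 0 ≤ a.2}

/-- Property (G1): closure under componentwise minimum. -/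
def MinClosed (E : Set Z2) : Prop := ∀ a ∈ E, ∀ b ∈ E, a ⊓ b ∈ E

/-- Property (G3). -/
def G3P (E : Set Z2) : Prop :=
  ∀ a ∈ E, ∀ b ∈ E, a ≠ b →
    (a.1 = b.1 →
      ∃ e ∈ E, a.1 < e.1 ∧ min a.2 b.2 ≤ e.2 ∧ (a.2 ≠ b.2 → e.2 = min a.2 b.2)) ∧
    (a.2 = b.2 →
      ∃ e ∈ E, a.2 < e.2 ∧ min a.1 b.1 ≤ e.1 ∧ (a.1 ≠ b.1 → e.1 = min a.1 b.1))

/-- A good semigroup of `ℕ²` (viewed inside `ℤ²`). -/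
def IsGood (S : Set Z2) : Prop :=
  S ⊆ orth ∧ (0 : Z2) ∈ S ∧ (∀ a ∈ S, ∀ b ∈ S, a + b ∈ S) ∧
  MinClosed S ∧ (∃ δ : Z2, ∀ y : Z2, δ ≤ y → y ∈ S) ∧ G3P S

/-- A good semigroup is local if its only element with a zero coordinate is `0`. -/
def IsLocal (S : Set Z2) : Prop := ∀ a ∈ S, (a.1 = 0 ∨ a.2 = 0) → a = 0

/-- A relative good ideal of `S`. -/
def IsRelGoodIdeal (S E : Set Z2) : Prop :=
  E.Nonempty ∧ (∀ e ∈ E, ∀ s ∈ S, e + s ∈ E) ∧ (∃ a ∈ S, ∀ e ∈ E, a + e ∈ S) ∧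
  MinClosed E ∧ G3P E

/-- A saturated chain of length `n` in `E`. -/
def IsSatChain (E : Set Z2) (n : ℕ) (f : ℕ → Z2) : Prop :=
  (∀ i ≤ n, f i ∈ E) ∧ (∀ i < n, f i < f (i + 1)) ∧
  (∀ i < n, ∀ c ∈ E, ¬ (f i < c ∧ c < f (i + 1)))

/-- `d_E(a,b)`: the common length of all saturated chains in `E` from `a` to `b`. -/
noncomputable def chainDist (E : Set Z2) (a b : Z2) : ℕ :=
  sSup {n : ℕ | ∃ f : ℕ → Z2, IsSatChain E n f ∧ f 0 = a ∧ f n = b}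

/-- The (componentwise) minimal element `e(E)` of `E`. -/
noncomputable def minEl (E : Set Z2) : Z2 :=
  (sInf (Prod.fst '' E), sInf (Prod.snd '' E))

/-- The distance `d(E∖F)` between `F ⊆ E`: the common value of
`d_E(e(E),α) - d_F(e(F),α)` for all sufficiently large `α ∈ F`. -/
noncomputable def dist2 (E F : Set Z2) : ℤ :=
  sSup {z : ℤ | ∃ β : Z2, ∀ α ∈ F, β ≤ α →
    (chainDist E (minEl E) α : ℤ) - (chainDist F (minEl F) α : ℤ) = z}

/-- The conductor `c(E)`: the componentwise minimal `δ` with `δ + ℕ² ⊆ E`. -/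
noncomputable def condE (E : Set Z2) : Z2 :=
  (sInf ((fun δ : Z2 => δ.1) '' {δ : Z2 | ∀ y : Z2, δ ≤ y → y ∈ E}),
   sInf ((fun δ : Z2 => δ.2) '' {δ : Z2 | ∀ y : Z2, δ ≤ y → y ∈ E}))

/-- The conductor ideal `C(E) = {β ∈ E : β ≥ c(E)}`. -/
noncomputable def CIdeal (E : Set Z2) : Set Z2 := {b ∈ E | condE E ≤ b}

/-- The length `l(E) = d(E ∖ C(E))`. -/
noncomputable def glen (E : Set Z2) : ℤ := dist2 E (CIdeal E)

/-- The genus `g(E) = d(ℕ² ∖ E)`. -/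
noncomputable def genus (E : Set Z2) : ℤ := dist2 orth E

/-- The good semigroup `ℕ²(1,1) = {0} ∪ ((1,1) + ℕ²)`. -/
def N2oneone : Set Z2 := {a : Z2 | a = 0 ∨ ((1 : ℤ), (1 : ℤ)) ≤ a}
/-- The space `(ℕ ∪ {∞})²`, modelled inside `(ℤ ∪ {∞})²`. -/
abbrev Om : Type := WithTop ℤ × WithTop ℤ

/-- The embedding of `ℤ²` into `(ℤ ∪ {∞})²`. -/
def iotaZ (a : Z2) : Om := ((a.1 : WithTop ℤ), (a.2 : WithTop ℤ))

/-- `S^∞`: the elements `(a,∞)` with `(a,c₂) ∈ S` and `(∞,b)` with `(c₁,b) ∈ S`,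
where `(c₁,c₂)` is the conductor of `S`. -/
noncomputable def Sinf (S : Set Z2) : Set Om :=
  {w : Om | (∃ a : ℤ, w = ((a : WithTop ℤ), ⊤) ∧ (a, (condE S).2) ∈ S) ∨
            (∃ b : ℤ, w = (⊤, (b : WithTop ℤ)) ∧ ((condE S).1, b) ∈ S)}

/-- `Γ_S = S ∪ S^∞`. -/
noncomputable def Gam (S : Set Z2) : Set Om := iotaZ '' S ∪ Sinf S

/-- `I(S)`: the set of irreducible elements of `Γ_S`. -/
noncomputable def ISet (S : Set Z2) : Set Om :=
  {w ∈ Gam S | w ≠ 0 ∧ ∀ b ∈ Gam S, ∀ c ∈ Gam S, w = b + c → w = b ∨ w = c}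

/-- `Δ(a) = Δ₁(a) ∪ Δ₂(a)` for a finite element `a ∈ ℤ²`. -/
def DeltaUp (a : Z2) : Set Z2 :=
  {b : Z2 | (b.1 = a.1 ∧ a.2 < b.2) ∨ (b.2 = a.2 ∧ a.1 < b.1)}

/-- `A_f(S)`: the finite maximals of `S`, i.e. `a ∈ S` with `Δ^S(a) = ∅`. -/
def Af (S : Set Z2) : Set Z2 := {a ∈ S | S ∩ DeltaUp a = ∅}

/-- `I_A(S)`: the irreducible maximals, i.e. irreducible elements of
`A(S) = A_f(S) ∪ S^∞`. -/
noncomputable def IA (S : Set Z2) : Set Om := ISet S ∩ (iotaZ '' Af S ∪ Sinf S)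

/-- `₁Δ(w)` (as a subset of `ℤ²`), including the conventions for infinite `w`. -/
def lowD1 (w : Om) : Set Z2 :=
  {b : Z2 | (b.1 : WithTop ℤ) = w.1 ∧ (b.2 : WithTop ℤ) < w.2}

/-- `₂Δ(w)` (as a subset of `ℤ²`), including the conventions for infinite `w`. -/
def lowD2 (w : Om) : Set Z2 :=
  {b : Z2 | (b.2 : WithTop ℤ) = w.2 ∧ (b.1 : WithTop ℤ) < w.1}

/-- `Δ(w)` (as a subset of `ℤ²`) for a possibly infinite `w`. -/
def upD (w : Om) : Set Z2 :=
  {b : Z2 | ((b.1 : WithTop ℤ) = w.1 ∧ w.2 < (b.2 : WithTop ℤ)) ∨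
            ((b.2 : WithTop ℤ) = w.2 ∧ w.1 < (b.1 : WithTop ℤ))}

/-- `{w} ∩ ℤ²`: the singleton of `w` if `w` is finite, `∅` otherwise. -/
def finPart (w : Om) : Set Z2 := {b : Z2 | iotaZ b = w}

/-- `a` and `b` are connected by a piece of track. -/
def Piece (S : Set Z2) (a b : Om) : Prop :=
  ¬ a ≤ b ∧ ¬ b ≤ a ∧ ∀ s ∈ S, s ∈ upD (a ⊓ b) → iotaZ s ∈ ISet S

/-- The data `α 0, …, α (n-1)` of a track of `S` (with `n ≥ 1` points;
`n = 1` gives the one-point tracks `T((α))`). -/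
def TrackData (S : Set Z2) (n : ℕ) (α : ℕ → Om) : Prop :=
  1 ≤ n ∧ (∀ i < n, α i ∈ IA S) ∧
  (∀ i j, i < j → j < n → (α i).1 < (α j).1) ∧
  (∀ s ∈ S, s ∈ lowD2 (α 0) → iotaZ s ∈ ISet S) ∧
  (∀ s ∈ S, s ∈ lowD1 (α (n - 1)) → iotaZ s ∈ ISet S) ∧
  (∀ i, i + 1 < n → Piece S (α i) (α (i + 1)))

/-- The track `T((α 0,…,α (n-1)))` as a subset of `S`. -/
def trackSet (S : Set Z2) (n : ℕ) (α : ℕ → Om) : Set Z2 :=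
  finPart (α 0) ∪ S ∩ lowD2 (α 0) ∪
  (⋃ i ∈ Finset.range (n - 1), S ∩ upD (α i ⊓ α (i + 1))) ∪
  S ∩ lowD1 (α (n - 1)) ∪ finPart (α (n - 1))

/-- `T` is a track of `S`. -/
def IsTrack (S T : Set Z2) : Prop :=
  ∃ (n : ℕ) (α : ℕ → Om), TrackData S n α ∧ T = trackSet S n α

/-- `T` is a beyond track of `S`: a track meeting `{a ∈ S : a ≥ c(S)}`. -/
noncomputable def IsBeyondTrack (S T : Set Z2) : Prop :=
  IsTrack S T ∧ (T ∩ {a ∈ S | condE S ≤ a}).Nonempty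

/-- `S` is a special parent of `S'`: `S` is a (local) good semigroup and
`S' = S ∖ T` for some beyond track `T` of `S`. -/
noncomputable def SpecialParent (S S' : Set Z2) : Prop :=
  IsGood S ∧ IsLocal S ∧ ∃ T : Set Z2, IsBeyondTrack S T ∧ S' = S \ T

/-- The levels of the tree of local good semigroups: `A₁ = {ℕ²(1,1)}` and
`A_{i+1}` consists of the special sons of the members of `A_i`. -/
noncomputable def Alevel : ℕ → Set (Set Z2)
  | 0 => ∅
  | 1 => {N2oneone}
  | n + 2 => {S' | ∃ S ∈ Alevel (n + 1), SpecialParent S S'}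

/-! ### Lengths of saturated chains -/

open Classical in
/-- `1` if some element of `E` lies on the column `x` at height at least `y`, and `0` otherwise. -/
noncomputable def colStep (E : Set Z2) (x y : ℤ) : ℤ := if ∃ z, y ≤ z ∧ (x, z) ∈ E then 1 else 0

open Classical in
/-- `1` if some element of `E` lies on the row `y` with abscissa at least `x`, and `0` otherwise. -/
noncomputable def rowStep (E : Set Z2) (x y : ℤ) : ℤ := if ∃ z, x ≤ z ∧ (z, y) ∈ E then 1 else 0

/-- The number of steps that meet `E` on the lattice path `(0,0) → (p₁,0) → (p₁,p₂)`. -/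
noncomputable def height (E : Set Z2) (p : Z2) : ℤ :=
  ∑ x ∈ Finset.Ico 0 p.1, colStep E x 0 + ∑ y ∈ Finset.Ico 0 p.2, rowStep E p.1 y

lemma Int.sum_Ico_add_one (f : ℤ → ℤ) {a b : ℤ} (h : a ≤ b) :
    ∑ x ∈ Finset.Ico a (b + 1), f x = ∑ x ∈ Finset.Ico a b, f x + f b := by
  have : Finset.Ico a (b + 1) = insert b (Finset.Ico a b) := by
    ext z; simp only [Finset.mem_Ico, Finset.mem_insert]; omega
  rw [this, Finset.sum_insert (by simp), add_comm]

open Classical in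
lemma ite_add_ite_of_iff {P P' Q Q' C : Prop} (hP : P ↔ C ∨ P') (hQ : Q ↔ C ∨ Q')
    (hC : C → (P' ↔ Q')) :
    (if P then (1 : ℤ) else 0) + (if Q' then 1 else 0) =
      (if Q then 1 else 0) + (if P' then 1 else 0) := by
  by_cases h : C <;> by_cases h' : P' <;> by_cases h'' : Q' <;> simp_all

lemma colStep_add_rowStep {E : Set Z2} (hE : G3P E) (x y : ℤ) :
    colStep E x y + rowStep E (x + 1) y = rowStep E x y + colStep E x (y + 1) := by
  have cornerOrUp : (∃ z, y ≤ z ∧ (x, z) ∈ E) ↔ (x, y) ∈ E ∨ ∃ z, y + 1 ≤ z ∧ (x, z) ∈ E := by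
    constructor
    · rintro ⟨z, hz, hm⟩
      rcases eq_or_lt_of_le hz with rfl | h
      exacts [Or.inl hm, Or.inr ⟨z, h, hm⟩]
    · rintro (h | ⟨z, hz, hm⟩)
      exacts [⟨y, le_rfl, h⟩, ⟨z, by omega, hm⟩]
  have cornerOrRight :
      (∃ z, x ≤ z ∧ (z, y) ∈ E) ↔ (x, y) ∈ E ∨ ∃ z, x + 1 ≤ z ∧ (z, y) ∈ E := by
    constructor
    · rintro ⟨z, hz, hm⟩
      rcases eq_or_lt_of_le hz with rfl | h
      exacts [Or.inl hm, Or.inr ⟨z, h, hm⟩]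
    · rintro (h | ⟨z, hz, hm⟩)
      exacts [⟨x, le_rfl, h⟩, ⟨z, by omega, hm⟩]
  have upIffRight : (x, y) ∈ E →
      ((∃ z, y + 1 ≤ z ∧ (x, z) ∈ E) ↔ ∃ z, x + 1 ≤ z ∧ (z, y) ∈ E) := by
    intro hp
    constructor
    · rintro ⟨z, hz, hm⟩
      obtain ⟨e, he, h1, -, h3⟩ := (hE _ hp _ hm (by simp; omega)).1 rfl
      have h3' : e.2 = y := by have := h3 (by simp; omega); simp at this; omega
      exact ⟨e.1, by simpa using h1, by rw [← h3']; exact he⟩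
    · rintro ⟨z, hz, hm⟩
      obtain ⟨e, he, h1, -, h3⟩ := (hE _ hp _ hm (by simp; omega)).2 rfl
      have h3' : e.1 = x := by have := h3 (by simp; omega); simp at this; omega
      exact ⟨e.2, by simpa using h1, by rw [← h3']; exact he⟩
  exact ite_add_ite_of_iff cornerOrUp cornerOrRight upIffRight

lemma height_add_one_left {E : Set Z2} (hE : G3P E) {x y : ℤ} (hx : 0 ≤ x) (hy : 0 ≤ y) :
    height E (x + 1, y) = height E (x, y) + colStep E x y := by
  induction y, hy using Int.leInduction with
  | base => simp [height, Int.sum_Ico_add_one _ hx]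
  | succ y hy ih =>
    simp only [height, Int.sum_Ico_add_one _ hy] at ih ⊢
    have := colStep_add_rowStep hE x y
    linarith

lemma height_add_one_right (E : Set Z2) {x y : ℤ} (hy : 0 ≤ y) :
    height E (x, y + 1) = height E (x, y) + rowStep E x y := by
  simp only [height, Int.sum_Ico_add_one _ hy]; ring

lemma height_eq_of_colStep {E : Set Z2} (hE : G3P E) {a b y : ℤ} (ha : 0 ≤ a) (hab : a ≤ b)
    (hy : 0 ≤ y) (h : ∀ x, a ≤ x → x < b → colStep E x y = 0) :
    height E (b, y) = height E (a, y) := by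
  induction b, hab using Int.leInduction with
  | base => rfl
  | succ b hb ih =>
    rw [height_add_one_left hE (ha.trans hb) hy, h b hb (by omega), add_zero]
    exact ih fun x h1 h2 => h x h1 (by omega)

lemma height_eq_of_rowStep (E : Set Z2) {a b x : ℤ} (ha : 0 ≤ a) (hab : a ≤ b)
    (h : ∀ y, a ≤ y → y < b → rowStep E x y = 0) :
    height E (x, b) = height E (x, a) := by
  induction b, hab using Int.leInduction with
  | base => rfl
  | succ b hb ih =>
    rw [height_add_one_right E (ha.trans hb), h b hb (by omega), add_zero]
    exact ih fun x h1 h2 => h x h1 (by omega)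

lemma height_consecutive {E : Set Z2} (hE : IsGood E) {a b : Z2} (ha : a ∈ E) (hb : b ∈ E)
    (hab : a < b) (hc : ∀ c ∈ E, ¬ (a < c ∧ c < b)) : height E b = height E a + 1 := by
  obtain ⟨hO, -, -, hmin, -, h3⟩ := hE
  obtain ⟨a1, a2⟩ := a
  obtain ⟨b1, b2⟩ := b
  have hpos := hO ha
  simp only [orth, Set.mem_ofPred_eq] at hpos
  obtain ⟨p1, p2⟩ := hpos
  have hc' : ∀ x y, (x, y) ∈ E → a1 ≤ x → a2 ≤ y → a1 < x ∨ a2 < y → x ≤ b1 → y ≤ b2 →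
      x < b1 ∨ y < b2 → False := by
    intro x y h h1 h2 h3 h4 h5 h6
    refine hc _ h ⟨Prod.lt_iff.2 ?_, Prod.lt_iff.2 ?_⟩ <;> simp only <;> omega
  have hminb : ∀ x y, (x, y) ∈ E → (min x b1, min y b2) ∈ E := fun x y h => hmin _ h _ hb
  have hle : a1 ≤ b1 ∧ a2 ≤ b2 := hab.le
  have hrow : ∀ y, a2 ≤ y → y < b2 → a1 < b1 ∨ a2 < y → rowStep E b1 y = 0 := by
    intro y h1 h2 h
    refine if_neg ?_
    rintro ⟨z, hz, hm⟩
    have := hminb _ _ hm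
    rw [min_eq_right hz, min_eq_left h2.le] at this
    exact hc' _ _ this (by omega) (by omega) (by omega) (by omega) (by omega) (by omega)
  rcases eq_or_lt_of_le hle.1 with h | h
  · subst h
    have h2 : a2 < b2 := by
      rcases Prod.lt_iff.1 hab with h | h <;> simp only at h <;> omega
    rw [height_eq_of_rowStep E (a := a2 + 1) (by omega) (by omega)
      fun y h1 h2 => hrow y (by omega) h2 (by omega), height_add_one_right E p2]
    congr 1
    exact if_pos ⟨a1, le_rfl, ha⟩
  · rw [height_eq_of_rowStep E p2 hle.2 fun y h1 h2 => hrow y h1 h2 (by omega),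
      height_eq_of_colStep h3 (a := a1 + 1) (by omega) (by omega) p2,
      height_add_one_left h3 p1 p2]
    · congr 1
      exact if_pos ⟨a2, le_rfl, ha⟩
    · intro x h1 h2
      refine if_neg ?_
      rintro ⟨z, hz, hm⟩
      have := hminb _ _ hm
      rw [min_eq_left h2.le] at this
      exact hc' _ _ this (by omega) (by omega) (by omega) (by omega) (by omega) (by omega)

lemma height_satChain {E : Set Z2} (hE : IsGood E) {n : ℕ} {f : ℕ → Z2} (hf : IsSatChain E n f)
    (h0 : f 0 = 0) : ∀ i ≤ n, height E (f i) = i := by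
  intro i
  induction i with
  | zero => intro _; simp [h0, height]
  | succ i ih =>
    intro hi
    rw [height_consecutive hE (hf.1 i (by omega)) (hf.1 _ hi) (hf.2.1 i hi) (hf.2.2 i hi),
      ih (by omega)]
    push_cast; rfl

lemma exists_satChain {E : Set Z2} (hE : IsGood E) (a : Z2) (ha : a ∈ E) :
    ∃ n f, IsSatChain E n f ∧ f 0 = 0 ∧ f n = a := by
  induction hk : (a.1 + a.2).toNat using Nat.strong_induction_on generalizing a with
  | _ k ih =>
  by_cases h0 : a = 0
  · exact ⟨0, fun _ => 0, ⟨fun _ _ => hE.2.1, by simp, by simp⟩, rfl, h0.symm⟩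
  have hpos := hE.1 ha
  have hlt : (0 : Z2) < a := lt_of_le_of_ne hpos (Ne.symm h0)
  have hfin : {b | b ∈ E ∧ b < a}.Finite :=
    (Set.finite_Icc (0 : Z2) a).subset fun b hb => ⟨hE.1 hb.1, hb.2.le⟩
  obtain ⟨b, ⟨hb, hba⟩, hmax⟩ := hfin.exists_maximal ⟨0, hE.2.1, hlt⟩
  have hbpos := hE.1 hb
  simp only [orth, Set.mem_ofPred_eq] at hpos hbpos
  obtain ⟨n, f, hf, hf0, hfn⟩ := ih (b.1 + b.2).toNat (by
    rcases Prod.lt_iff.1 hba with h | h <;> omega) b hb rfl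
  refine ⟨n + 1, fun i => if i ≤ n then f i else a, ⟨?_, ?_, ?_⟩, by simp [hf0], by simp⟩
  · intro i hi
    dsimp only
    split_ifs with h
    exacts [hf.1 i h, ha]
  · intro i hi
    rcases Nat.lt_succ_iff_lt_or_eq.1 hi with h | rfl
    · simpa [h.le, Nat.succ_le_iff.2 h] using hf.2.1 i h
    · simpa [hfn] using hba
  · intro i hi c hc
    rcases Nat.lt_succ_iff_lt_or_eq.1 hi with h | rfl
    · simpa [h.le, Nat.succ_le_iff.2 h] using hf.2.2 i h c hc
    · simp only [le_refl, if_true, hfn, Nat.not_succ_le_self, if_false]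
      rintro ⟨h1, h2⟩
      exact absurd (hmax ⟨hc, h2⟩ h1.le) h1.not_ge

lemma chainDist_zero {E : Set Z2} (hE : IsGood E) {a : Z2} (ha : a ∈ E) :
    (chainDist E 0 a : ℤ) = height E a := by
  obtain ⟨n, f, hf, h0, hn⟩ := exists_satChain hE a ha
  have hlen : height E a = n := hn ▸ height_satChain hE hf h0 n le_rfl
  have : {n : ℕ | ∃ f : ℕ → Z2, IsSatChain E n f ∧ f 0 = 0 ∧ f n = a} = {n} := by
    refine Set.eq_singleton_iff_unique_mem.2 ⟨⟨f, hf, h0, hn⟩, ?_⟩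
    rintro m ⟨g, hg, hg0, hgm⟩
    have := height_satChain hE hg hg0 m le_rfl
    rw [hgm, hlen] at this
    exact_mod_cast this.symm
  rw [chainDist, this, csSup_singleton, hlen]

lemma minEl_eq_zero {E : Set Z2} (hE : IsGood E) : minEl E = 0 := by
  have h1 : IsLeast (Prod.fst '' E) (0 : ℤ) :=
    ⟨⟨0, hE.2.1, rfl⟩, by rintro _ ⟨a, ha, rfl⟩; exact (hE.1 ha).1⟩
  have h2 : IsLeast (Prod.snd '' E) (0 : ℤ) :=
    ⟨⟨0, hE.2.1, rfl⟩, by rintro _ ⟨a, ha, rfl⟩; exact (hE.1 ha).2⟩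
  rw [minEl, h1.csInf_eq, h2.csInf_eq]; rfl

/-! ### The genus as a number of gaps -/

/-- The columns that do not meet `E`. -/
def colGaps (E : Set Z2) : Set ℤ := {x | 0 ≤ x ∧ ∀ y, (x, y) ∉ E}

/-- The rows that meet `E` in finitely many points only. -/
def rowGaps (E : Set Z2) : Set ℤ := {y | 0 ≤ y ∧ ∃ X, ∀ x, X ≤ x → (x, y) ∉ E}

lemma IsGood.row_mem {S : Set Z2} (hS : IsGood S) {p q : ℤ}
    (hδ : ∀ y : Z2, (p, q) ≤ y → y ∈ S) {z y : ℤ} (hz : (z, y) ∈ S) (hp : p ≤ z) {x : ℤ}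
    (hx : p ≤ x) : (x, y) ∈ S := by
  obtain ⟨-, -, -, hmin, -, h3⟩ := hS
  have hle : ∀ w, (w, y) ∈ S → x ≤ w → (x, y) ∈ S := by
    intro w hw hxw
    have := hmin _ hw (x, max q y) (hδ _ ⟨hx, le_max_left _ _⟩)
    rwa [show ((w, y) : Z2) ⊓ (x, max q y) = (x, y) from
      Prod.ext (min_eq_right hxw) (min_eq_left (le_max_right _ _))] at this
  have hcof : ∀ n : ℕ, ∃ w, z + n ≤ w ∧ (w, y) ∈ S := by
    intro n
    induction n with
    | zero => exact ⟨z, by simp, hz⟩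
    | succ n ih =>
      obtain ⟨w, hw, hm⟩ := ih
      obtain ⟨e, he, h1, -, h2⟩ := (h3 _ hm (w, max q y + 1)
        (hδ _ ⟨by show p ≤ w; omega, by show q ≤ max q y + 1; omega⟩)
        (by simp only [ne_eq, Prod.mk.injEq]; omega)).1 rfl
      have h2' : e.2 = y := by
        have := h2 (by simp only; omega)
        simp only at this; omega
      refine ⟨e.1, ?_, h2' ▸ he⟩
      simp only at h1
      push_cast; omega
  obtain ⟨w, hw, hm⟩ := hcof (x - z).toNat
  exact hle w hm (by omega)

lemma IsGood.col_mem {S : Set Z2} (hS : IsGood S) {p q : ℤ}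
    (hδ : ∀ y : Z2, (p, q) ≤ y → y ∈ S) {z x : ℤ} (hz : (x, z) ∈ S) (hp : q ≤ z) {y : ℤ}
    (hy : q ≤ y) : (x, y) ∈ S := by
  obtain ⟨-, -, -, hmin, -, h3⟩ := hS
  have hle : ∀ w, (x, w) ∈ S → y ≤ w → (x, y) ∈ S := by
    intro w hw hyw
    have := hmin _ hw (max p x, y) (hδ _ ⟨le_max_left _ _, hy⟩)
    rwa [show ((x, w) : Z2) ⊓ (max p x, y) = (x, y) from
      Prod.ext (min_eq_left (le_max_right _ _)) (min_eq_right hyw)] at this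
  have hcof : ∀ n : ℕ, ∃ w, z + n ≤ w ∧ (x, w) ∈ S := by
    intro n
    induction n with
    | zero => exact ⟨z, by simp, hz⟩
    | succ n ih =>
      obtain ⟨w, hw, hm⟩ := ih
      obtain ⟨e, he, h1, -, h2⟩ := (h3 _ hm (max p x + 1, w)
        (hδ _ ⟨by show p ≤ max p x + 1; omega, by show q ≤ w; omega⟩)
        (by simp only [ne_eq, Prod.mk.injEq]; omega)).2 rfl
      have h2' : e.1 = x := by
        have := h2 (by simp only; omega)
        simp only at this; omega
      refine ⟨e.2, ?_, h2' ▸ he⟩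
      simp only at h1
      push_cast; omega
  obtain ⟨w, hw, hm⟩ := hcof (y - z).toNat
  exact hle w hm (by omega)

lemma isGood_orth : IsGood orth := by
  refine ⟨subset_rfl, ⟨le_rfl, le_rfl⟩, fun a ha b hb => ⟨add_nonneg ha.1 hb.1,
    add_nonneg ha.2 hb.2⟩, fun a ha b hb => ⟨le_min ha.1 hb.1, le_min ha.2 hb.2⟩,
    ⟨0, fun y hy => hy⟩, fun a ha b hb _ => ⟨fun _ => ?_, fun _ => ?_⟩⟩
  · exact ⟨(a.1 + 1, min a.2 b.2), ⟨by have := ha.1; show 0 ≤ a.1 + 1; omega,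
      le_min ha.2 hb.2⟩, by simp, le_rfl, fun _ => rfl⟩
  · exact ⟨(min a.1 b.1, a.2 + 1), ⟨le_min ha.1 hb.1, by
      have := ha.2; show 0 ≤ a.2 + 1; omega⟩, by simp, le_rfl, fun _ => rfl⟩

lemma IsGood.colGaps_subset {S : Set Z2} {p q : ℤ} (hδ : ∀ y : Z2, (p, q) ≤ y → y ∈ S) :
    colGaps S ⊆ Finset.Ico 0 p := by
  rintro x ⟨h0, h⟩
  have : ¬ p ≤ x := fun hx => h q (hδ _ ⟨hx, le_rfl⟩)
  simp; omega

lemma IsGood.rowGaps_subset {S : Set Z2} {p q : ℤ} (hδ : ∀ y : Z2, (p, q) ≤ y → y ∈ S) :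
    rowGaps S ⊆ Finset.Ico 0 q := by
  rintro y ⟨h0, X, h⟩
  have : ¬ q ≤ y := fun hy => h (max p X) (le_max_right _ _) (hδ _ ⟨le_max_left _ _, hy⟩)
  simp; omega

lemma IsGood.finite_colGaps {S : Set Z2} (hS : IsGood S) : (colGaps S).Finite := by
  obtain ⟨δ, hδ⟩ := hS.2.2.2.2.1
  exact (Finset.finite_toSet _).subset (IsGood.colGaps_subset (p := δ.1) (q := δ.2) hδ)

lemma IsGood.finite_rowGaps {S : Set Z2} (hS : IsGood S) : (rowGaps S).Finite := by
  obtain ⟨δ, hδ⟩ := hS.2.2.2.2.1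
  exact (Finset.finite_toSet _).subset (IsGood.rowGaps_subset (p := δ.1) (q := δ.2) hδ)

open Classical in
lemma Int.sum_indicator_Ico {P : ℤ → Prop} {b : ℤ} {G : Set ℤ} (hb : 0 ≤ b)
    (hG : G ⊆ Finset.Ico 0 b) (h : ∀ x, 0 ≤ x → x < b → (P x ↔ x ∉ G)) :
    ∑ x ∈ Finset.Ico 0 b, (if P x then (1 : ℤ) else 0) = b - G.ncard := by
  have hGe : G = ((Finset.Ico 0 b).filter (fun x => ¬ P x) : Finset ℤ) := by
    ext x
    have h' := fun hx : x ∈ G => hG hx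
    simp only [Finset.coe_Ico, Set.mem_Ico] at h'
    simp only [Finset.coe_filter, Finset.mem_Ico, Set.mem_ofPred_eq]
    constructor
    · intro hx
      have := h' hx
      exact ⟨this, by rw [h x this.1 this.2]; simpa using hx⟩
    · rintro ⟨⟨h1, h2⟩, h3⟩
      rw [h x h1 h2] at h3; simpa using h3
  have hcard := Finset.card_filter_add_card_filter_not (s := Finset.Ico 0 b) (fun x => P x)
  rw [Finset.sum_boole, hGe, Set.ncard_coe_finset]
  rw [Int.card_Ico] at hcard
  omega

theorem genus_eq {S : Set Z2} (hS : IsGood S) :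
    genus S = (colGaps S).ncard + (rowGaps S).ncard := by
  obtain ⟨⟨p, q⟩, hδ⟩ := hS.2.2.2.2.1
  have hpq := hS.1 (hδ _ le_rfl)
  simp only [orth, Set.mem_ofPred_eq] at hpq
  have hval : ∀ α ∈ S, (p, q) ≤ α → (chainDist orth (minEl orth) α : ℤ) -
      (chainDist S (minEl S) α : ℤ) = (colGaps S).ncard + (rowGaps S).ncard := by
    rintro ⟨a, b⟩ hα ⟨ha, hb⟩
    simp only at ha hb
    have h0 : (a, b) ∈ orth := hS.1 hα
    have hcol := IsGood.colGaps_subset hδ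
    have hrow := IsGood.rowGaps_subset hδ
    rw [minEl_eq_zero hS, minEl_eq_zero isGood_orth, chainDist_zero hS hα,
      chainDist_zero isGood_orth h0]
    simp only [height, colStep, rowStep]
    rw [Int.sum_indicator_Ico (G := ∅) (by omega) (by simp),
      Int.sum_indicator_Ico (G := ∅) (by omega) (by simp),
      Int.sum_indicator_Ico (G := colGaps S) (by omega),
      Int.sum_indicator_Ico (G := rowGaps S) (by omega)]
    · simp; ring
    · refine hrow.trans ?_
      intro x; simp; omega
    · intro y hy _
      constructor
      · rintro ⟨z, hz, hm⟩ ⟨-, X, hX⟩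
        exact hX (max p X) (le_max_right _ _)
          (hS.row_mem hδ hm (by omega) (le_max_left _ _))
      · intro hn
        by_contra hcon
        push Not at hcon
        exact hn ⟨hy, a, fun x hx => hcon x hx⟩
    · refine hcol.trans ?_
      intro x; simp; omega
    · intro x hx _
      constructor
      · rintro ⟨z, hz, hm⟩ ⟨-, h⟩
        exact h z hm
      · intro hn
        by_contra hcon
        push Not at hcon
        exact hn ⟨hx, fun y hy => hcon y (hS.1 hy).2 hy⟩
    · intro y hy _
      exact iff_of_true ⟨a, le_rfl, h0.1, hy⟩ (by simp)
    · intro x hx _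
      exact iff_of_true ⟨0, le_rfl, hx, le_rfl⟩ (by simp)
  have : {z : ℤ | ∃ β : Z2, ∀ α ∈ S, β ≤ α → (chainDist orth (minEl orth) α : ℤ) -
      (chainDist S (minEl S) α : ℤ) = z} = {((colGaps S).ncard + (rowGaps S).ncard : ℤ)} := by
    refine Set.eq_singleton_iff_unique_mem.2 ⟨⟨_, hval⟩, ?_⟩
    rintro z ⟨β, hβ⟩
    have hm : (p, q) ⊔ β ∈ S := hδ _ le_sup_left
    rw [← hβ _ hm le_sup_right, hval _ hm le_sup_left]
  rw [genus, dist2, this, csSup_singleton]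

lemma g3P_of_lt {S : Set Z2}
    (hright : ∀ a ∈ S, ∀ b ∈ S, a.1 = b.1 → a.2 < b.2 → ∃ e ∈ S, a.1 < e.1 ∧ e.2 = a.2)
    (hup : ∀ a ∈ S, ∀ b ∈ S, a.2 = b.2 → a.1 < b.1 → ∃ e ∈ S, a.2 < e.2 ∧ e.1 = a.1) :
    G3P S := by
  intro a ha b hb hab
  refine ⟨fun h => ?_, fun h => ?_⟩
  · rcases lt_trichotomy a.2 b.2 with h' | h' | h'
    · obtain ⟨e, he, h1, h2⟩ := hright a ha b hb h h'
      have : e.2 = min a.2 b.2 := by rw [h2, min_eq_left h'.le]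
      exact ⟨e, he, h1, this.ge, fun _ => this⟩
    · exact absurd (Prod.ext h h') hab
    · obtain ⟨e, he, h1, h2⟩ := hright b hb a ha h.symm h'
      have : e.2 = min a.2 b.2 := by rw [h2, min_eq_right h'.le]
      exact ⟨e, he, h ▸ h1, this.ge, fun _ => this⟩
  · rcases lt_trichotomy a.1 b.1 with h' | h' | h'
    · obtain ⟨e, he, h1, h2⟩ := hup a ha b hb h h'
      have : e.1 = min a.1 b.1 := by rw [h2, min_eq_left h'.le]
      exact ⟨e, he, h1, this.ge, fun _ => this⟩
    · exact absurd (Prod.ext h' h) hab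
    · obtain ⟨e, he, h1, h2⟩ := hup b hb a ha h.symm h'
      have : e.1 = min a.1 b.1 := by rw [h2, min_eq_right h'.le]
      exact ⟨e, he, h ▸ h1, this.ge, fun _ => this⟩

/-! ### Removing a staircase -/

/-- A finite antichain of (possibly infinite) maximals of `S`. -/
structure IsStaircase (S : Set Z2) (A : Set Om) : Prop where
  finite : A.Finite
  nonempty : A.Nonempty
  antichain : ∀ a ∈ A, ∀ b ∈ A, a ≤ b → a = b
  ne_top : ∀ a ∈ A, ¬ (a.1 = ⊤ ∧ a.2 = ⊤)
  approx : ∀ a ∈ A, ∀ p : Z2, iotaZ p ≤ a → ∃ s ∈ S, p ≤ s ∧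
    ((p.1 : WithTop ℤ) < a.1 → p.1 < s.1) ∧ ((p.2 : WithTop ℤ) < a.2 → p.2 < s.2) ∧
    (∀ k : ℤ, a.1 = k → s.1 = k) ∧ (∀ k : ℤ, a.2 = k → s.2 = k)
  le_snd : ∀ a ∈ A, ∀ s ∈ S, (s.1 : WithTop ℤ) = a.1 → (s.2 : WithTop ℤ) ≤ a.2
  le_fst : ∀ a ∈ A, ∀ s ∈ S, (s.2 : WithTop ℤ) = a.2 → (s.1 : WithTop ℤ) ≤ a.1

/-- The elements of `S` lying below exactly one corner of the staircase `A`,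
on the same row or column as that corner. -/
def stairSet (S : Set Z2) (A : Set Om) : Set Z2 :=
  {s | s ∈ S ∧ ∃ a ∈ A, iotaZ s ≤ a ∧ ((s.1 : WithTop ℤ) = a.1 ∨ (s.2 : WithTop ℤ) = a.2) ∧
    ∀ b ∈ A, iotaZ s ≤ b → b = a}

lemma iotaZ_mono {s t : Z2} (h : s ≤ t) : iotaZ s ≤ iotaZ t :=
  ⟨WithTop.coe_le_coe.2 h.1, WithTop.coe_le_coe.2 h.2⟩

namespace IsStaircase

variable {S : Set Z2} {A : Set Om}

lemma eq_of_fst (hA : IsStaircase S A) {a b : Om} (ha : a ∈ A) (hb : b ∈ A) (h : a.1 = b.1) :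
    a = b := by
  rcases le_total a.2 b.2 with h' | h'
  · exact hA.antichain a ha b hb ⟨h.le, h'⟩
  · exact (hA.antichain b hb a ha ⟨h.ge, h'⟩).symm

lemma swap (hA : IsStaircase S A) : IsStaircase (Prod.swap ⁻¹' S) (Prod.swap ⁻¹' A) where
  finite := hA.finite.preimage Prod.swap_injective.injOn
  nonempty := by
    obtain ⟨a, ha⟩ := hA.nonempty
    exact ⟨a.swap, by simpa using ha⟩
  antichain a ha b hb h := Prod.swap_injective (hA.antichain _ ha _ hb ⟨h.2, h.1⟩)
  ne_top a ha h := hA.ne_top _ ha ⟨h.2, h.1⟩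
  approx a ha p hp := by
    obtain ⟨s, hs, h, h1, h2, h3, h4⟩ := hA.approx _ ha p.swap ⟨hp.2, hp.1⟩
    exact ⟨s.swap, by simpa using hs, ⟨h.2, h.1⟩, h2, h1, h4, h3⟩
  le_snd a ha s hs h := hA.le_fst _ ha _ hs h
  le_fst a ha s hs h := hA.le_snd _ ha _ hs h

lemma stairSet_swap {s : Z2} (hs : s ∈ stairSet (Prod.swap ⁻¹' S) (Prod.swap ⁻¹' A)) :
    s.swap ∈ stairSet S A := by
  obtain ⟨h, a, ha, hle, hor, hu⟩ := hs
  exact ⟨h, a.swap, ha, ⟨hle.2, hle.1⟩, hor.symm, fun b hb hsb => by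
    rw [← hu b.swap (by simpa using hb) ⟨hsb.2, hsb.1⟩, Prod.swap_swap]⟩

lemma mem_stairSet_of_le (hA : IsStaircase S A) {s t : Z2} (hs : s ∈ stairSet S A) (ht : t ∈ S)
    (hst : s ≤ t) (h : ∀ a ∈ A, iotaZ s ≤ a →
      (s.1 : WithTop ℤ) = a.1 ∧ t.1 = s.1 ∨ (s.2 : WithTop ℤ) = a.2 ∧ t.2 = s.2) :
    t ∈ stairSet S A := by
  obtain ⟨_, a, ha, hle, -, hu⟩ := hs
  rcases h a ha hle with ⟨h1, h2⟩ | ⟨h1, h2⟩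
  · have h1' : (t.1 : WithTop ℤ) = a.1 := by rw [h2, h1]
    exact ⟨ht, a, ha, ⟨h1'.le, hA.le_snd a ha t ht h1'⟩, Or.inl h1', fun b hb htb =>
      hu b hb ((iotaZ_mono hst).trans htb)⟩
  · have h1' : (t.2 : WithTop ℤ) = a.2 := by rw [h2, h1]
    exact ⟨ht, a, ha, ⟨hA.le_fst a ha t ht h1', h1'.le⟩, Or.inr h1', fun b hb htb =>
      hu b hb ((iotaZ_mono hst).trans htb)⟩

lemma minClosed_diff (hA : IsStaircase S A) (hmin : MinClosed S) :
    MinClosed (S \ stairSet S A) := by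
  rintro s ⟨hs, hs'⟩ t ⟨ht, ht'⟩
  refine ⟨hmin _ hs _ ht, fun hm => ?_⟩
  obtain ⟨_, a, ha, hle, hor, hu⟩ := id hm
  have hone : ∀ b ∈ A, iotaZ (s ⊓ t) ≤ b → b = a := hu
  rcases hor with h | h
  · rcases min_choice s.1 t.1 with h' | h'
    · exact hs' (hA.mem_stairSet_of_le hm hs inf_le_left fun b hb hb' => by
        rw [hone b hb hb']; exact Or.inl ⟨h, h'.symm⟩)
    · exact ht' (hA.mem_stairSet_of_le hm ht inf_le_right fun b hb hb' => by
        rw [hone b hb hb']; exact Or.inl ⟨h, h'.symm⟩)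
  · rcases min_choice s.2 t.2 with h' | h'
    · exact hs' (hA.mem_stairSet_of_le hm hs inf_le_left fun b hb hb' => by
        rw [hone b hb hb']; exact Or.inr ⟨h, h'.symm⟩)
    · exact ht' (hA.mem_stairSet_of_le hm ht inf_le_right fun b hb hb' => by
        rw [hone b hb hb']; exact Or.inr ⟨h, h'.symm⟩)

lemma exists_right_of_lt (h3 : G3P S) {a b : Z2} (ha : a ∈ S) (hb : b ∈ S) (h1 : a.1 = b.1)
    (h2 : a.2 < b.2) : ∃ e ∈ S, a.1 < e.1 ∧ e.2 = a.2 := by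
  obtain ⟨e, he, h, -, h'⟩ := (h3 a ha b hb (fun h => by rw [h] at h2; exact h2.false)).1 h1
  exact ⟨e, he, h, by rw [h' h2.ne, min_eq_left h2.le]⟩

lemma exists_up_of_lt (h3 : G3P S) {a b : Z2} (ha : a ∈ S) (hb : b ∈ S) (h1 : a.2 = b.2)
    (h2 : a.1 < b.1) : ∃ e ∈ S, a.2 < e.2 ∧ e.1 = a.1 := by
  obtain ⟨e, he, h, -, h'⟩ := (h3 a ha b hb (fun h => by rw [h] at h2; exact h2.false)).2 h1
  exact ⟨e, he, h, by rw [h' h2.ne, min_eq_left h2.le]⟩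

lemma notMem_stairSet_of_two {s : Z2} {a b : Om} (ha : a ∈ A) (hb : b ∈ A) (hab : a ≠ b)
    (hsa : iotaZ s ≤ a) (hsb : iotaZ s ≤ b) : s ∉ stairSet S A := by
  rintro ⟨_, c, -, -, -, hu⟩
  exact hab ((hu a ha hsa).trans (hu b hb hsb).symm)

lemma exists_other {s : Z2} {a : Om} (hs : s ∈ S) (hs' : s ∉ stairSet S A) (ha : a ∈ A)
    (hle : iotaZ s ≤ a) (hor : (s.1 : WithTop ℤ) = a.1 ∨ (s.2 : WithTop ℤ) = a.2) :
    ∃ b ∈ A, iotaZ s ≤ b ∧ b ≠ a := by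
  by_contra hcon
  push Not at hcon
  exact hs' ⟨hs, a, ha, hle, hor, hcon⟩

lemma exists_right (hA : IsStaircase S A) (hmin : MinClosed S) (h3 : G3P S) {a b : Z2}
    (ha : a ∈ S) (ha' : a ∉ stairSet S A) (hb : b ∈ S) (hb' : b ∉ stairSet S A)
    (h1 : a.1 = b.1) (h2 : a.2 < b.2) :
    ∃ e ∈ S \ stairSet S A, a.1 < e.1 ∧ e.2 = a.2 := by
  by_contra hcon
  have hT : ∀ e ∈ S, a.1 < e.1 → e.2 = a.2 → e ∈ stairSet S A := by
    intro e he h h'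
    by_contra hn
    exact hcon ⟨e, ⟨he, hn⟩, h, h'⟩
  obtain ⟨e, he, hlt, heq⟩ := exists_right_of_lt h3 ha hb h1 h2
  obtain ⟨-, α, hα, hle, hor, hu⟩ := hT e he hlt heq
  have hae : iotaZ a ≤ iotaZ e := iotaZ_mono ⟨hlt.le, heq.ge⟩
  by_cases hrow : (e.2 : WithTop ℤ) = α.2
  · have hβ : ∀ β ∈ A, iotaZ a ≤ β → β ≠ α → (a.1 : WithTop ℤ) = β.1 := by
      intro β hβ haβ hne
      have hlt' : β.1 < (e.1 : WithTop ℤ) := by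
        by_contra hn
        exact hne (hu β hβ ⟨not_lt.1 hn, by
          show (e.2 : WithTop ℤ) ≤ β.2
          rw [heq]; exact haβ.2⟩)
      obtain ⟨k, hk⟩ := WithTop.ne_top_iff_exists.1 (hlt'.trans_le le_top).ne
      have hke : k < e.1 := by rw [← hk] at hlt'; exact_mod_cast hlt'
      have hak : a.1 ≤ k := by
        have : (a.1 : WithTop ℤ) ≤ β.1 := haβ.1
        rw [← hk] at this; exact_mod_cast this
      rcases eq_or_lt_of_le hak with h | h
      · rw [h, hk]
      · exfalso
        obtain ⟨s, hs, has, -, -, hs1, -⟩ := hA.approx β hβ a haβ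
        have hm : ((k, a.2) : Z2) ∈ S := by
          have := hmin s hs e he
          rwa [show s ⊓ e = (k, a.2) from Prod.ext
            (by show min s.1 e.1 = k; rw [hs1 k hk.symm]; exact min_eq_left hke.le)
            (by show min s.2 e.2 = a.2; rw [heq]; exact min_eq_right has.2)] at this
        refine notMem_stairSet_of_two (s := (k, a.2)) hα hβ hne.symm ?_ ⟨hk.le, haβ.2⟩ (hT _ hm h rfl)
        exact (iotaZ_mono (s := (k, a.2)) ⟨hke.le, heq.ge⟩).trans hle
    obtain ⟨β, hβA, haβ, hne⟩ := exists_other ha ha' hα (hae.trans hle) (Or.inr (heq ▸ hrow))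
    have hbβ1 : (b.1 : WithTop ℤ) = β.1 := by rw [← h1]; exact hβ β hβA haβ hne
    obtain ⟨β', hβA', hbβ', hne'⟩ := exists_other hb hb' hβA
      ⟨hbβ1.le, hA.le_snd β hβA b hb hbβ1⟩ (Or.inl hbβ1)
    have hne2 : β' ≠ α := by
      rintro rfl
      have : (b.2 : WithTop ℤ) ≤ β'.2 := hbβ'.2
      rw [← hrow, heq] at this
      exact h2.not_ge (by exact_mod_cast this)
    have haβ' := hβ β' hβA' ((iotaZ_mono ⟨h1.le, h2.le⟩).trans hbβ') hne2
    exact hne' (hA.eq_of_fst hβA' hβA (haβ'.symm.trans (hβ β hβA haβ hne)))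
  · have hcol : (e.1 : WithTop ℤ) = α.1 := hor.resolve_right hrow
    obtain ⟨s, hs, -, -, hs2, hs1, -⟩ := hA.approx α hα e hle
    obtain ⟨e', he', hlt', heq'⟩ := exists_right_of_lt h3 he hs (hs1 _ hcol.symm).symm
      (hs2 (lt_of_le_of_ne hle.2 hrow))
    obtain ⟨-, α', hα', hle', -, -⟩ := hT e' he' (hlt.trans hlt') (heq'.trans heq)
    have := hu α' hα' ((iotaZ_mono ⟨hlt'.le, heq'.ge⟩).trans hle')
    have h4 : (e'.1 : WithTop ℤ) ≤ α.1 := this ▸ hle'.1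
    rw [← hcol] at h4
    exact hlt'.not_ge (by exact_mod_cast h4)

lemma minClosed_swap (hmin : MinClosed S) : MinClosed (Prod.swap ⁻¹' S) :=
  fun a ha b hb => hmin a.swap ha b.swap hb

lemma g3P_swap (h3 : G3P S) : G3P (Prod.swap ⁻¹' S) := by
  intro a ha b hb hab
  obtain ⟨h1, h2⟩ := h3 a.swap ha b.swap hb (fun h => hab (Prod.swap_injective h))
  refine ⟨fun h => ?_, fun h => ?_⟩
  · obtain ⟨e, he, h⟩ := h2 h
    exact ⟨e.swap, by simpa using he, h⟩
  · obtain ⟨e, he, h⟩ := h1 h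
    exact ⟨e.swap, by simpa using he, h⟩

lemma stairSet_swap_iff {s : Z2} :
    s ∈ stairSet (Prod.swap ⁻¹' S) (Prod.swap ⁻¹' A) ↔ s.swap ∈ stairSet S A := by
  refine ⟨stairSet_swap, fun hs => ?_⟩
  have := @stairSet_swap (Prod.swap ⁻¹' S) (Prod.swap ⁻¹' A) s.swap
  simp only [← Set.preimage_comp, Prod.swap_swap_eq, Set.preimage_id, Prod.swap_swap] at this
  exact this hs

lemma exists_up (hA : IsStaircase S A) (hmin : MinClosed S) (h3 : G3P S) {a b : Z2}
    (ha : a ∈ S) (ha' : a ∉ stairSet S A) (hb : b ∈ S) (hb' : b ∉ stairSet S A)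
    (h1 : a.2 = b.2) (h2 : a.1 < b.1) :
    ∃ e ∈ S \ stairSet S A, a.2 < e.2 ∧ e.1 = a.1 := by
  obtain ⟨e, ⟨he, he'⟩, h⟩ := hA.swap.exists_right (minClosed_swap hmin) (g3P_swap h3)
    (a := a.swap) (b := b.swap) (by simpa using ha) (by simpa [stairSet_swap_iff] using ha')
    (by simpa using hb) (by simpa [stairSet_swap_iff] using hb') h1 h2
  exact ⟨e.swap, ⟨he, by simpa [stairSet_swap_iff] using he'⟩, h⟩

lemma g3P_diff (hA : IsStaircase S A) (hmin : MinClosed S) (h3 : G3P S) :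
    G3P (S \ stairSet S A) :=
  g3P_of_lt (fun _ ha _ hb => hA.exists_right hmin h3 ha.1 ha.2 hb.1 hb.2)
    fun _ ha _ hb => hA.exists_up hmin h3 ha.1 ha.2 hb.1 hb.2

lemma exists_bound_fst (hA : IsStaircase S A) : ∃ N : ℤ, ∀ a ∈ A, ∀ k : ℤ, a.1 = k → k < N := by
  have hfin : ((↑) ⁻¹' (Prod.fst '' A) : Set ℤ).Finite :=
    (hA.finite.image _).preimage WithTop.coe_injective.injOn
  obtain ⟨N, hN⟩ := hfin.bddAbove
  exact ⟨N + 1, fun a ha k hk => Int.lt_add_one_iff.2 (hN ⟨a, ha, hk⟩)⟩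

theorem isGood_diff (hA : IsStaircase S A) (hS : IsGood S)
    (hirr : ∀ s ∈ stairSet S A, iotaZ s ∈ ISet S) : IsGood (S \ stairSet S A) := by
  obtain ⟨hO, h0, hadd, hmin, ⟨δ, hδ⟩, h3⟩ := hS
  refine ⟨Set.sdiff_subset.trans hO, ⟨h0, fun h => (hirr 0 h).2.1 rfl⟩, ?_,
    hA.minClosed_diff hmin, ?_, hA.g3P_diff hmin h3⟩
  · rintro a ⟨ha, ha'⟩ b ⟨hb, hb'⟩
    refine ⟨hadd a ha b hb, fun h => ?_⟩
    have hinj : Function.Injective iotaZ := fun s t h => by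
      simpa [iotaZ, Prod.ext_iff] using h
    rcases (hirr _ h).2.2 (iotaZ a) (Or.inl ⟨a, ha, rfl⟩) (iotaZ b) (Or.inl ⟨b, hb, rfl⟩)
      (by simp [iotaZ]) with h' | h'
    · exact ha' (hinj h' ▸ h)
    · exact hb' (hinj h' ▸ h)
  · obtain ⟨N, hN⟩ := hA.exists_bound_fst
    obtain ⟨M, hM⟩ := hA.swap.exists_bound_fst
    refine ⟨δ ⊔ (N, M), fun y hy => ⟨hδ y (le_sup_left.trans hy), ?_⟩⟩
    have hy' : (N, M) ≤ y := le_sup_right.trans hy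
    rintro ⟨-, a, ha, -, h | h, -⟩
    · exact (hN a ha _ h.symm).not_ge hy'.1
    · exact (hM a.swap (by simpa using ha) _ h.symm).not_ge hy'.2

lemma exists_col_mem_diff (hA : IsStaircase S A) (hmin : MinClosed S) (h3 : G3P S) {ω : Om}
    (hω : ω ∈ A) (hmax : ∀ a ∈ A, a.1 ≤ ω.1) {s : Z2} (hs : s ∈ S)
    (hne : (s.1 : WithTop ℤ) ≠ ω.1) : ∃ y, (s.1, y) ∈ S \ stairSet S A := by
  by_cases hs' : s ∉ stairSet S A
  · exact ⟨s.2, hs, hs'⟩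
  obtain ⟨-, α, hα, hle, hor, hu⟩ := not_not.1 hs'
  by_cases h1 : (s.1 : WithTop ℤ) = α.1
  · have hαω : α ≠ ω := fun h => hne (h ▸ h1)
    have hlt2 : ω.2 < α.2 := by
      by_contra hn
      exact hαω (hA.antichain α hα ω hω ⟨hmax α hα, not_lt.1 hn⟩)
    obtain ⟨k, hk⟩ := WithTop.ne_top_iff_exists.1 (hlt2.trans_le le_top).ne
    have hγω : iotaZ (s.1, k) ≤ ω := ⟨h1.le.trans (hmax α hα), hk.le⟩
    have hγα : iotaZ (s.1, k) ≤ α := ⟨h1.le, hk.le.trans hlt2.le⟩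
    obtain ⟨t, ht, hst, -, -, -, ht2⟩ := hA.approx ω hω (s.1, k) hγω
    obtain ⟨r, hr, hkr, -, -, hr1, -⟩ := hA.approx α hα (s.1, k) hγα
    refine ⟨k, ?_, notMem_stairSet_of_two hα hω hαω hγα hγω⟩
    have := hmin t ht r hr
    rwa [show t ⊓ r = (s.1, k) from Prod.ext
      (by show min t.1 r.1 = s.1; rw [hr1 _ h1.symm]; exact min_eq_right hst.1)
      (by show min t.2 r.2 = k; rw [ht2 _ hk.symm]; exact min_eq_left hkr.2)] at this
  · have h2 : (s.2 : WithTop ℤ) = α.2 := hor.resolve_left h1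
    obtain ⟨t, ht, -, ht1, -, -, ht2⟩ := hA.approx α hα s hle
    obtain ⟨e, he, hlt, heq⟩ := exists_up_of_lt h3 hs ht (ht2 _ h2.symm).symm
      (ht1 (lt_of_le_of_ne hle.1 h1))
    refine ⟨e.2, heq ▸ he, fun h => ?_⟩
    obtain ⟨-, α', hα', hle', -⟩ := h
    have := hu α' hα' ((iotaZ_mono (s := s) (t := (s.1, e.2)) ⟨le_rfl, hlt.le⟩).trans hle')
    have h4 : (e.2 : WithTop ℤ) ≤ α.2 := this ▸ hle'.2
    rw [← h2] at h4
    exact hlt.not_ge (by exact_mod_cast h4)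

lemma colGaps_diff (hA : IsStaircase S A) (hmin : MinClosed S) (h3 : G3P S) {ω : Om}
    (hω : ω ∈ A) (hmax : ∀ a ∈ A, a.1 ≤ ω.1) {x : ℤ} (hx : (x : WithTop ℤ) ≠ ω.1) :
    x ∈ colGaps (S \ stairSet S A) ↔ x ∈ colGaps S := by
  refine and_congr_right fun _ => ⟨fun h y hy => ?_, fun h y hy => h y hy.1⟩
  obtain ⟨y', hy'⟩ := hA.exists_col_mem_diff hmin h3 hω hmax hy hx
  exact h y' hy'

lemma rowGaps_diff (hA : IsStaircase S A) {ω : Om}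
    (hω : ω ∈ A) (hmax : ∀ a ∈ A, a.1 ≤ ω.1) {y : ℤ} (hy : ω ≠ (⊤, (y : WithTop ℤ))) :
    y ∈ rowGaps (S \ stairSet S A) ↔ y ∈ rowGaps S := by
  obtain ⟨N, hN⟩ := hA.exists_bound_fst
  refine and_congr_right fun _ =>
    ⟨fun ⟨X, hX⟩ => ⟨max X N, fun x hx hm => ?_⟩, fun ⟨X, hX⟩ => ⟨X, fun x hx h => hX x hx h.1⟩⟩
  refine hX x ((le_max_left _ _).trans hx) ⟨hm, ?_⟩
  rintro ⟨-, a, ha, hle, hor, -⟩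
  have hNx : N ≤ x := (le_max_right _ _).trans hx
  have htop : a.1 = ⊤ := by
    by_contra hne
    obtain ⟨k, hk⟩ := WithTop.ne_top_iff_exists.1 hne
    have h1 : (x : WithTop ℤ) ≤ a.1 := hle.1
    rw [← hk] at h1
    have h1' : x ≤ k := by exact_mod_cast h1
    have := hN a ha k hk.symm
    omega
  have haω : a = ω := hA.eq_of_fst ha hω (le_antisymm (hmax a ha) (htop ▸ le_top))
  rcases hor with h | h
  · rw [htop] at h; exact WithTop.coe_ne_top h
  · exact hy (haω ▸ Prod.ext htop h.symm)

theorem genus_diff (hA : IsStaircase S A) (hS : IsGood S)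
    (hirr : ∀ s ∈ stairSet S A, iotaZ s ∈ ISet S) :
    genus (S \ stairSet S A) = genus S + 1 := by
  have hS' := hA.isGood_diff hS hirr
  rw [genus_eq hS, genus_eq hS']
  obtain ⟨hO, -, -, hmin, -, h3⟩ := id hS
  obtain ⟨ω, hω, hmax⟩ := Set.exists_max_image A Prod.fst hA.finite hA.nonempty
  rcases eq_or_ne ω.1 ⊤ with htop | htop
  · obtain ⟨k, hk⟩ := WithTop.ne_top_iff_exists.1 fun h => hA.ne_top ω hω ⟨htop, h⟩
    have hcol : colGaps (S \ stairSet S A) = colGaps S := by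
      ext x
      exact hA.colGaps_diff hmin h3 hω hmax (by rw [htop]; exact WithTop.coe_ne_top)
    have happrox : ∀ X : ℤ, ∃ x, X ≤ x ∧ (x, k) ∈ S := by
      intro X
      obtain ⟨s, hs, hle, -, -, -, h2⟩ := hA.approx ω hω (X, k) ⟨htop ▸ le_top, hk.le⟩
      exact ⟨s.1, hle.1, by rw [← h2 k hk.symm]; exact hs⟩
    have hknot : k ∉ rowGaps S := by
      rintro ⟨-, X, hX⟩
      obtain ⟨x, hx, hm⟩ := happrox X
      exact hX x hx hm
    have hrow : rowGaps (S \ stairSet S A) = insert k (rowGaps S) := by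
      ext y
      rw [Set.mem_insert_iff]
      by_cases hy : y = k
      · subst hy
        refine iff_of_true ?_ (Or.inl rfl)
        obtain ⟨N, hN⟩ := hA.exists_bound_fst
        obtain ⟨x₀, -, hm₀⟩ := happrox 0
        refine ⟨(hO hm₀).2, N, fun x hx h => h.2 ⟨h.1, ω, hω, ⟨htop ▸ le_top, hk.le⟩,
          Or.inr hk, fun b hb hle => ?_⟩⟩
        refine hA.eq_of_fst hb hω ?_
        rw [htop]
        by_contra hne
        obtain ⟨j, hj⟩ := WithTop.ne_top_iff_exists.1 hne
        have h1 : (x : WithTop ℤ) ≤ b.1 := hle.1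
        rw [← hj] at h1
        have h1' : x ≤ j := by exact_mod_cast h1
        have := hN b hb j hj.symm
        omega
      · rw [hA.rowGaps_diff hω hmax (y := y) (fun h => hy ?_)]
        · simp [hy]
        · rw [h] at hk
          exact (WithTop.coe_injective hk).symm
    rw [hcol, hrow, Set.ncard_insert_of_notMem hknot hS.finite_rowGaps]
    push_cast; ring
  · obtain ⟨k, hk⟩ := WithTop.ne_top_iff_exists.1 htop
    have hrow : rowGaps (S \ stairSet S A) = rowGaps S := by
      ext y
      exact hA.rowGaps_diff hω hmax (fun h => htop (by rw [h]))
    have hcolmem : ∃ y, (k, y) ∈ S := by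
      rcases eq_or_ne ω.2 ⊤ with h | h
      · obtain ⟨s, hs, -, -, -, h1, -⟩ := hA.approx ω hω (k, 0) ⟨hk.le, h ▸ le_top⟩
        exact ⟨s.2, by rw [← h1 k hk.symm]; exact hs⟩
      · obtain ⟨j, hj⟩ := WithTop.ne_top_iff_exists.1 h
        obtain ⟨s, hs, -, -, -, h1, -⟩ := hA.approx ω hω (k, j) ⟨hk.le, hj.le⟩
        exact ⟨s.2, by rw [← h1 k hk.symm]; exact hs⟩
    obtain ⟨y₀, hy₀⟩ := hcolmem
    have hknot : k ∉ colGaps S := fun h => h.2 y₀ hy₀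
    have hcol : colGaps (S \ stairSet S A) = insert k (colGaps S) := by
      ext x
      rw [Set.mem_insert_iff]
      by_cases hx : x = k
      · subst hx
        refine iff_of_true ⟨(hO hy₀).1, fun y hy => hy.2 ⟨hy.1, ω, hω,
          ⟨hk.le, hA.le_snd ω hω _ hy.1 hk⟩, Or.inl hk, fun b hb hle => ?_⟩⟩ (Or.inl rfl)
        exact hA.eq_of_fst hb hω (le_antisymm (hmax b hb) (hk ▸ hle.1))
      · rw [hA.colGaps_diff hmin h3 hω hmax (x := x)
          (fun h => hx (WithTop.coe_injective (h.trans hk.symm)))]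
        simp [hx]
    rw [hcol, hrow, Set.ncard_insert_of_notMem hknot hS.finite_colGaps]
    push_cast; ring

end IsStaircase

/-! ### Tracks are staircases -/

lemma condE_le {S : Set Z2} (hS : IsGood S) {δ : Z2} (hδ : ∀ y : Z2, δ ≤ y → y ∈ S) :
    condE S ≤ δ := by
  refine ⟨csInf_le ⟨0, ?_⟩ ⟨δ, hδ, rfl⟩, csInf_le ⟨0, ?_⟩ ⟨δ, hδ, rfl⟩⟩
  · rintro _ ⟨d, hd, rfl⟩
    exact (hS.1 (hd d le_rfl)).1
  · rintro _ ⟨d, hd, rfl⟩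
    exact (hS.1 (hd d le_rfl)).2

lemma mem_of_condE_le {S : Set Z2} (hS : IsGood S) {y : Z2} (hy : condE S ≤ y) : y ∈ S := by
  obtain ⟨δ, hδ⟩ := hS.2.2.2.2.1
  obtain ⟨d, hd, h1⟩ := Int.csInf_mem
    (s := (fun δ : Z2 => δ.1) '' {δ : Z2 | ∀ y : Z2, δ ≤ y → y ∈ S}) ⟨_, δ, hδ, rfl⟩
    ⟨0, by rintro _ ⟨d, hd, rfl⟩; exact (hS.1 (hd d le_rfl)).1⟩
  obtain ⟨e, he, h2⟩ := Int.csInf_mem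
    (s := (fun δ : Z2 => δ.2) '' {δ : Z2 | ∀ y : Z2, δ ≤ y → y ∈ S}) ⟨_, δ, hδ, rfl⟩
    ⟨0, by rintro _ ⟨d, hd, rfl⟩; exact (hS.1 (hd d le_rfl)).2⟩
  have hy1 : d.1 ≤ y.1 := h1.trans_le hy.1
  have hy2 : e.2 ≤ y.2 := h2.trans_le hy.2
  have := hS.2.2.2.1 (y.1, max y.2 d.2) (hd _ ⟨hy1, le_max_right _ _⟩)
    (max y.1 e.1, y.2) (he _ ⟨le_max_right _ _, hy2⟩)
  rwa [show ((y.1, max y.2 d.2) : Z2) ⊓ (max y.1 e.1, y.2) = y from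
    Prod.ext (min_eq_left (le_max_left _ _)) (min_eq_right (le_max_left _ _))] at this

lemma IA_cases {S : Set Z2} {w : Om} (hw : w ∈ IA S) :
    (∃ s ∈ Af S, w = iotaZ s) ∨ (∃ a : ℤ, w = ((a : WithTop ℤ), ⊤) ∧ (a, (condE S).2) ∈ S) ∨
      ∃ b : ℤ, w = (⊤, (b : WithTop ℤ)) ∧ ((condE S).1, b) ∈ S := by
  rcases hw.2 with ⟨s, hs, h⟩ | h
  · exact Or.inl ⟨s, hs, h.symm⟩
  · exact Or.inr h

lemma IA_approx {S : Set Z2} (hS : IsGood S) {w : Om} (hw : w ∈ IA S) (p : Z2)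
    (hp : iotaZ p ≤ w) : ∃ s ∈ S, p ≤ s ∧
    ((p.1 : WithTop ℤ) < w.1 → p.1 < s.1) ∧ ((p.2 : WithTop ℤ) < w.2 → p.2 < s.2) ∧
    (∀ k : ℤ, w.1 = k → s.1 = k) ∧ (∀ k : ℤ, w.2 = k → s.2 = k) := by
  have hδ : ∀ y : Z2, ((condE S).1, (condE S).2) ≤ y → y ∈ S := fun y hy => mem_of_condE_le hS hy
  rcases IA_cases hw with ⟨s, hs, rfl⟩ | ⟨a, rfl, ha⟩ | ⟨b, rfl, hb⟩
  · refine ⟨s, hs.1, ⟨WithTop.coe_le_coe.1 hp.1, WithTop.coe_le_coe.1 hp.2⟩,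
      fun h => WithTop.coe_lt_coe.1 h, fun h => WithTop.coe_lt_coe.1 h,
      fun k hk => WithTop.coe_injective hk, fun k hk => WithTop.coe_injective hk⟩
  · refine ⟨(a, max (condE S).2 (p.2 + 1)), hS.col_mem hδ ha le_rfl (le_max_left _ _),
      ⟨WithTop.coe_le_coe.1 hp.1, ?_⟩, fun h => WithTop.coe_lt_coe.1 h, fun _ => ?_,
      fun k hk => WithTop.coe_injective hk, fun k hk => absurd hk.symm WithTop.coe_ne_top⟩
    · show p.2 ≤ max (condE S).2 (p.2 + 1)
      omega
    · show p.2 < max (condE S).2 (p.2 + 1)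
      omega
  · refine ⟨(max (condE S).1 (p.1 + 1), b), hS.row_mem hδ hb le_rfl (le_max_left _ _),
      ⟨?_, WithTop.coe_le_coe.1 hp.2⟩, fun _ => ?_, fun h => WithTop.coe_lt_coe.1 h,
      fun k hk => absurd hk.symm WithTop.coe_ne_top, fun k hk => WithTop.coe_injective hk⟩
    · show p.1 ≤ max (condE S).1 (p.1 + 1)
      omega
    · show p.1 < max (condE S).1 (p.1 + 1)
      omega

lemma IA_le_snd {S : Set Z2} {w : Om} (hw : w ∈ IA S) {s : Z2} (hs : s ∈ S)
    (h : (s.1 : WithTop ℤ) = w.1) : (s.2 : WithTop ℤ) ≤ w.2 := by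
  rcases IA_cases hw with ⟨t, ht, rfl⟩ | ⟨a, rfl, ha⟩ | ⟨b, rfl, hb⟩
  · by_contra hn
    have : s ∈ S ∩ DeltaUp t :=
      ⟨hs, Or.inl ⟨WithTop.coe_injective h, WithTop.coe_lt_coe.1 (not_le.1 hn)⟩⟩
    rw [ht.2] at this
    exact this
  · exact le_top
  · exact absurd h WithTop.coe_ne_top

lemma IA_le_fst {S : Set Z2} {w : Om} (hw : w ∈ IA S) {s : Z2} (hs : s ∈ S)
    (h : (s.2 : WithTop ℤ) = w.2) : (s.1 : WithTop ℤ) ≤ w.1 := by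
  rcases IA_cases hw with ⟨t, ht, rfl⟩ | ⟨a, rfl, ha⟩ | ⟨b, rfl, hb⟩
  · by_contra hn
    have : s ∈ S ∩ DeltaUp t :=
      ⟨hs, Or.inr ⟨WithTop.coe_injective h, WithTop.coe_lt_coe.1 (not_le.1 hn)⟩⟩
    rw [ht.2] at this
    exact this
  · exact absurd h WithTop.coe_ne_top
  · exact le_top

lemma IA_ne_top {S : Set Z2} {w : Om} (hw : w ∈ IA S) : ¬ (w.1 = ⊤ ∧ w.2 = ⊤) := by
  rcases IA_cases hw with ⟨t, ht, rfl⟩ | ⟨a, rfl, ha⟩ | ⟨b, rfl, hb⟩ <;> simp [iotaZ]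

lemma mem_of_iotaZ_mem_IA {S : Set Z2} {s : Z2} (h : iotaZ s ∈ IA S) : s ∈ S := by
  rcases IA_cases h with ⟨t, ht, h⟩ | ⟨a, h, ha⟩ | ⟨b, h, hb⟩
  · have : s = t := by simpa [iotaZ, Prod.ext_iff] using h
    exact this ▸ ht.1
  · simp [iotaZ, Prod.ext_iff] at h
  · simp [iotaZ, Prod.ext_iff] at h

namespace TrackData

variable {S : Set Z2} {n : ℕ} {α : ℕ → Om}

lemma snd_lt (h : TrackData S n α) {i j : ℕ} (hij : i < j) (hj : j < n) :
    (α j).2 < (α i).2 := by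
  have hstep : ∀ i, i + 1 < n → (α (i + 1)).2 < (α i).2 := by
    intro i hi
    by_contra hn
    exact (h.2.2.2.2.2 i hi).1 ⟨(h.2.2.1 i (i + 1) (by omega) hi).le, not_lt.1 hn⟩
  induction j, hij using Nat.le_induction with
  | base => exact hstep i hj
  | succ j hij ih => exact (hstep j hj).trans (ih (by omega))

lemma inf_succ (h : TrackData S n α) {i : ℕ} (hi : i + 1 < n) :
    α i ⊓ α (i + 1) = ((α i).1, (α (i + 1)).2) :=
  Prod.ext (min_eq_left (h.2.2.1 i (i + 1) (by omega) hi).le)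
    (min_eq_right (h.snd_lt (by omega) hi).le)

lemma eq_of_le (h : TrackData S n α) {i j : ℕ} (hi : i < n) (hj : j < n) (hij : α i ≤ α j) :
    i = j := by
  rcases lt_trichotomy i j with h' | h' | h'
  · exact absurd hij.2 (h.snd_lt h' hj).not_ge
  · exact h'
  · exact absurd hij.1 (h.2.2.1 j i h' hi).not_ge

lemma isStaircase (h : TrackData S n α) (hS : IsGood S) :
    IsStaircase S (α '' {i | i < n}) where
  finite := (Set.finite_lt_nat n).image α
  nonempty := ⟨α 0, 0, h.1, rfl⟩
  antichain := by
    rintro _ ⟨i, hi, rfl⟩ _ ⟨j, hj, rfl⟩ hij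
    rw [h.eq_of_le hi hj hij]
  ne_top := by
    rintro _ ⟨i, hi, rfl⟩
    exact IA_ne_top (h.2.1 i hi)
  approx := by
    rintro _ ⟨i, hi, rfl⟩
    exact IA_approx hS (h.2.1 i hi)
  le_snd := by
    rintro _ ⟨i, hi, rfl⟩ s hs
    exact IA_le_snd (h.2.1 i hi) hs
  le_fst := by
    rintro _ ⟨i, hi, rfl⟩ s hs
    exact IA_le_fst (h.2.1 i hi) hs

lemma mem_stairSet_of_col (h : TrackData S n α) {s : Z2} (hs : s ∈ S) {i : ℕ} (hi : i < n)
    (h1 : (s.1 : WithTop ℤ) = (α i).1) (h2 : i + 1 < n → (α (i + 1)).2 < (s.2 : WithTop ℤ)) :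
    s ∈ stairSet S (α '' {i | i < n}) := by
  refine ⟨hs, α i, ⟨i, hi, rfl⟩, ⟨h1.le, IA_le_snd (h.2.1 i hi) hs h1⟩, Or.inl h1, ?_⟩
  rintro _ ⟨j, hj, rfl⟩ hle
  rcases lt_trichotomy i j with h' | rfl | h'
  · have hj' : j < n := hj
    have h3 : (α j).2 ≤ (α (i + 1)).2 := by
      rcases eq_or_lt_of_le (Nat.succ_le_of_lt h') with h' | h'
      · rw [← h']
      · exact (h.snd_lt h' hj).le
    exact absurd hle.2 (h3.trans_lt (h2 (by omega))).not_ge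
  · rfl
  · have : (s.1 : WithTop ℤ) ≤ (α j).1 := hle.1
    rw [h1] at this
    exact absurd this (h.2.2.1 j i h' hi).not_ge

lemma mem_stairSet_of_row (h : TrackData S n α) {s : Z2} (hs : s ∈ S) {i : ℕ} (hi : i < n)
    (h1 : (s.2 : WithTop ℤ) = (α i).2) (h2 : i ≠ 0 → (α (i - 1)).1 < (s.1 : WithTop ℤ)) :
    s ∈ stairSet S (α '' {i | i < n}) := by
  refine ⟨hs, α i, ⟨i, hi, rfl⟩, ⟨IA_le_fst (h.2.1 i hi) hs h1, h1.le⟩, Or.inr h1, ?_⟩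
  rintro _ ⟨j, hj, rfl⟩ hle
  rcases lt_trichotomy i j with h' | rfl | h'
  · have : (s.2 : WithTop ℤ) ≤ (α j).2 := hle.2
    rw [h1] at this
    exact absurd this (h.snd_lt h' hj).not_ge
  · rfl
  · have h3 : (α j).1 ≤ (α (i - 1)).1 := by
      rcases eq_or_lt_of_le (Nat.le_sub_one_of_lt h') with h' | h'
      · rw [← h']
      · exact (h.2.2.1 _ _ h' (by omega)).le
    exact absurd hle.1 (h3.trans_lt (h2 (by omega))).not_ge

lemma trackSet_eq (h : TrackData S n α) : trackSet S n α = stairSet S (α '' {i | i < n}) := by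
  have hn := h.1
  ext s
  simp only [trackSet, Set.mem_union, Set.mem_iUnion, Finset.mem_range, Set.mem_inter_iff,
    exists_prop]
  constructor
  · rintro ((((hs | hs) | ⟨i, hi, hs, hu⟩) | hs) | hs)
    · have hs' : iotaZ s = α 0 := hs
      exact h.mem_stairSet_of_row (mem_of_iotaZ_mem_IA (hs' ▸ h.2.1 0 h.1)) h.1
        (congrArg Prod.snd hs') (by simp)
    · exact h.mem_stairSet_of_row hs.1 h.1 hs.2.1 (by simp)
    · rw [h.inf_succ (by omega)] at hu
      rcases hu with hu | hu
      · exact h.mem_stairSet_of_col hs (i := i) (by omega) hu.1 fun _ => hu.2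
      · exact h.mem_stairSet_of_row hs (i := i + 1) (by omega) hu.1 fun _ => hu.2
    · exact h.mem_stairSet_of_col hs.1 (by omega) hs.2.1 fun _ => by omega
    · have hs' : iotaZ s = α (n - 1) := hs
      exact h.mem_stairSet_of_col (mem_of_iotaZ_mem_IA (hs' ▸ h.2.1 (n - 1) (by omega)))
        (by omega) (congrArg Prod.fst hs') fun _ => by omega
  · rintro ⟨hs, _, ⟨i, hi, rfl⟩, hle, hor, hu⟩
    have hi' : i < n := hi
    have huniq : ∀ j < n, iotaZ s ≤ α j → j = i := fun j hj hsj =>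
      h.eq_of_le hj hi (hu _ ⟨j, hj, rfl⟩ hsj).le
    rcases hor with h1 | h1
    · by_cases hlast : i + 1 < n
      · refine Or.inl (Or.inl (Or.inr ⟨i, by omega, hs, ?_⟩))
        rw [h.inf_succ hlast]
        refine Or.inl ⟨h1, ?_⟩
        by_contra hn
        have := huniq (i + 1) hlast
          ⟨h1.le.trans (h.2.2.1 i (i + 1) (by omega) hlast).le, not_lt.1 hn⟩
        omega
      · obtain rfl : i = n - 1 := by omega
        rcases eq_or_lt_of_le hle.2 with h2 | h2
        · exact Or.inr (Prod.ext h1 h2)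
        · exact Or.inl (Or.inr ⟨hs, h1, h2⟩)
    · rcases Nat.eq_zero_or_pos i with rfl | hpos
      · rcases eq_or_lt_of_le hle.1 with h2 | h2
        · exact Or.inl (Or.inl (Or.inl (Or.inl (Prod.ext h2 h1))))
        · exact Or.inl (Or.inl (Or.inl (Or.inr ⟨hs, h1, h2⟩)))
      · obtain ⟨j, rfl⟩ : ∃ j, i = j + 1 := ⟨i - 1, by omega⟩
        refine Or.inl (Or.inl (Or.inr ⟨j, by omega, hs, ?_⟩))
        rw [h.inf_succ hi]
        refine Or.inr ⟨h1, ?_⟩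
        by_contra hn
        have := huniq j (by omega) ⟨not_lt.1 hn, h1.le.trans (h.snd_lt (by omega) hi).le⟩
        omega

lemma irreducible (h : TrackData S n α) : ∀ s ∈ trackSet S n α, iotaZ s ∈ ISet S := by
  have hn := h.1
  intro s hs
  simp only [trackSet, Set.mem_union, Set.mem_iUnion, Finset.mem_range, Set.mem_inter_iff,
    exists_prop] at hs
  rcases hs with (((hs | hs) | ⟨i, hi, hs, hu⟩) | hs) | hs
  · have hs' : iotaZ s = α 0 := hs
    exact hs' ▸ (h.2.1 0 h.1).1
  · exact h.2.2.2.1 s hs.1 hs.2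
  · exact (h.2.2.2.2.2 i (by omega)).2.2 s hs hu
  · exact h.2.2.2.2.1 s hs.1 hs.2
  · have hs' : iotaZ s = α (n - 1) := hs
    exact hs' ▸ (h.2.1 _ (by omega)).1

end TrackData

theorem SpecialParent.son {S S' : Set Z2} (h : SpecialParent S S') :
    IsGood S' ∧ IsLocal S' ∧ genus S' = genus S + 1 := by
  obtain ⟨hS, hloc, T, ⟨⟨n, α, hα, rfl⟩, -⟩, rfl⟩ := h
  have hirr := hα.irreducible
  rw [hα.trackSet_eq] at hirr ⊢
  exact ⟨(hα.isStaircase hS).isGood_diff hS hirr, fun a ha => hloc a ha.1,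
    (hα.isStaircase hS).genus_diff hS hirr⟩

/-! ### Irreducible elements of `Γ_S` -/

lemma Gam_exists_col {S : Set Z2} {w : Om} (hw : w ∈ Gam S) {x : ℤ} (h : w.1 = x) :
    ∃ y, (x, y) ∈ S := by
  rcases hw with ⟨s, hs, rfl⟩ | ⟨a, rfl, ha⟩ | ⟨b, rfl, hb⟩
  · obtain rfl : s.1 = x := WithTop.coe_injective h
    exact ⟨s.2, hs⟩
  · obtain rfl : a = x := WithTop.coe_injective h
    exact ⟨_, ha⟩
  · exact absurd h.symm WithTop.coe_ne_top

lemma Gam_exists_row {S : Set Z2} {w : Om} (hw : w ∈ Gam S) {y : ℤ} (h : w.2 = y) :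
    ∃ x, (x, y) ∈ S := by
  rcases hw with ⟨s, hs, rfl⟩ | ⟨a, rfl, ha⟩ | ⟨b, rfl, hb⟩
  · obtain rfl : s.2 = y := WithTop.coe_injective h
    exact ⟨s.1, hs⟩
  · exact absurd h.symm WithTop.coe_ne_top
  · obtain rfl : b = y := WithTop.coe_injective h
    exact ⟨_, hb⟩

lemma Gam_col_mem {S : Set Z2} (hS : IsGood S) {x : ℤ} (hw : ((x : WithTop ℤ), ⊤) ∈ Gam S)
    {y : ℤ} (hy : (condE S).2 ≤ y) : (x, y) ∈ S := by
  have hδ : ∀ y : Z2, ((condE S).1, (condE S).2) ≤ y → y ∈ S := fun y hy => mem_of_condE_le hS hy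
  rcases hw with ⟨s, hs, h⟩ | ⟨a, h, ha⟩ | ⟨b, h, hb⟩
  · exact absurd (congrArg Prod.snd h) WithTop.coe_ne_top
  · obtain rfl : x = a := WithTop.coe_injective (congrArg Prod.fst h)
    exact hS.col_mem hδ ha le_rfl hy
  · exact absurd (congrArg Prod.fst h) WithTop.coe_ne_top

lemma Gam_row_mem {S : Set Z2} (hS : IsGood S) {y : ℤ} (hw : (⊤, (y : WithTop ℤ)) ∈ Gam S)
    {x : ℤ} (hx : (condE S).1 ≤ x) : (x, y) ∈ S := by
  have hδ : ∀ y : Z2, ((condE S).1, (condE S).2) ≤ y → y ∈ S := fun y hy => mem_of_condE_le hS hy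
  rcases hw with ⟨s, hs, h⟩ | ⟨a, h, ha⟩ | ⟨b, h, hb⟩
  · exact absurd (congrArg Prod.fst h) WithTop.coe_ne_top
  · exact absurd (congrArg Prod.snd h) WithTop.coe_ne_top
  · obtain rfl : y = b := WithTop.coe_injective (congrArg Prod.snd h)
    exact hS.row_mem hδ hb le_rfl hx

lemma Gam_eq_zero_of_fst {S : Set Z2} (hS : IsGood S) (hl : IsLocal S) {w : Om}
    (hw : w ∈ Gam S) (h : w.1 = ((0 : ℤ) : WithTop ℤ)) : w = 0 := by
  obtain ⟨w1, w2⟩ := w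
  obtain rfl : w1 = ((0 : ℤ) : WithTop ℤ) := h
  induction w2 using WithTop.recTopCoe with
  | top =>
    have h1 := hl _ (Gam_col_mem hS hw (y := (condE S).2) le_rfl) (Or.inl rfl)
    have h2 := hl _ (Gam_col_mem hS hw (y := (condE S).2 + 1) (by omega)) (Or.inl rfl)
    simp only [Prod.mk_eq_zero] at h1 h2
    omega
  | coe y =>
    rcases hw with ⟨s, hs, h⟩ | ⟨a, h, ha⟩ | ⟨b, h, hb⟩
    · have h1 : s.1 = 0 := WithTop.coe_injective (congrArg Prod.fst h)
      rw [← h, hl s hs (Or.inl h1)]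
      rfl
    · exact absurd (congrArg Prod.snd h) WithTop.coe_ne_top
    · exact absurd (congrArg Prod.fst h) WithTop.coe_ne_top

lemma Gam_eq_zero_of_snd {S : Set Z2} (hS : IsGood S) (hl : IsLocal S) {w : Om}
    (hw : w ∈ Gam S) (h : w.2 = ((0 : ℤ) : WithTop ℤ)) : w = 0 := by
  obtain ⟨w1, w2⟩ := w
  obtain rfl : w2 = ((0 : ℤ) : WithTop ℤ) := h
  induction w1 using WithTop.recTopCoe with
  | top =>
    have h1 := hl _ (Gam_row_mem hS hw (x := (condE S).1) le_rfl) (Or.inr rfl)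
    have h2 := hl _ (Gam_row_mem hS hw (x := (condE S).1 + 1) (by omega)) (Or.inr rfl)
    simp only [Prod.mk_eq_zero] at h1 h2
    omega
  | coe x =>
    rcases hw with ⟨s, hs, h⟩ | ⟨a, h, ha⟩ | ⟨b, h, hb⟩
    · have h1 : s.2 = 0 := WithTop.coe_injective (congrArg Prod.snd h)
      rw [← h, hl s hs (Or.inr h1)]
      rfl
    · exact absurd (congrArg Prod.snd h) WithTop.coe_ne_top
    · exact absurd (congrArg Prod.fst h) WithTop.coe_ne_top

/-- An infinite column that becomes finite in a subsemigroup `S` of `P`, all columns of `P`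
to its left lying in `S`, gives an irreducible element of `Γ_P`. -/
lemma infinite_col_mem_ISet {S P : Set Z2} (hP : IsGood P) (hl : IsLocal P)
    (hadd : ∀ a ∈ S, ∀ b ∈ S, a + b ∈ S) {f N : ℤ}
    (hmem : (f, (condE P).2) ∈ P) (hlow : ∀ s ∈ P, s.1 < f → s ∈ S)
    (hbd : ∀ y, N ≤ y → (f, y) ∉ S) : ((f : WithTop ℤ), (⊤ : WithTop ℤ)) ∈ ISet P := by
  have key : ∀ b ∈ Gam P, ∀ c ∈ Gam P, ((f : WithTop ℤ), (⊤ : WithTop ℤ)) = b + c →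
      b.2 = ⊤ → ((f : WithTop ℤ), (⊤ : WithTop ℤ)) = b := by
    rintro ⟨b1, b2⟩ hb c hc h (rfl : b2 = ⊤)
    obtain ⟨x, x', rfl, hx', hxx⟩ := WithTop.add_eq_coe.1 (congrArg Prod.fst h).symm
    obtain ⟨y', hy'⟩ := Gam_exists_col hc hx'.symm
    have hxpos := (hP.1 (Gam_col_mem hP hb le_rfl)).1
    have hx'pos := (hP.1 hy').1
    simp only at hxpos hx'pos
    rcases eq_or_lt_of_le hxpos with h0 | hxpos
    · have := congrArg Prod.snd (Gam_eq_zero_of_fst hP hl hb (by rw [h0]))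
      exact absurd this WithTop.top_ne_zero
    rcases eq_or_lt_of_le hx'pos with h0 | hx'pos
    · rw [Gam_eq_zero_of_fst hP hl hc (by rw [← hx', h0]), add_zero] at h
      exact h
    exfalso
    have h1 := hadd _ (hlow _ (Gam_col_mem hP hb
        (y := max (condE P).2 (N - y')) (le_max_left _ _)) (by show x < f; omega))
      _ (hlow _ hy' (by show x' < f; omega))
    rw [Prod.mk_add_mk, hxx] at h1
    exact hbd _ (by omega) h1
  refine ⟨Or.inr (Or.inl ⟨f, rfl, hmem⟩), fun h => ?_, fun b hb c hc h => ?_⟩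
  · exact absurd (congrArg Prod.snd h) WithTop.top_ne_zero
  · rcases WithTop.add_eq_top.1 (congrArg Prod.snd h).symm with h' | h'
    · exact Or.inl (key b hb c hc h h')
    · exact Or.inr (key c hc b hb (h.trans (add_comm b c)) h')

/-- The analogue of `infinite_col_mem_ISet` for rows. -/
lemma infinite_row_mem_ISet {S P : Set Z2} (hP : IsGood P) (hl : IsLocal P)
    (hadd : ∀ a ∈ S, ∀ b ∈ S, a + b ∈ S) {f N : ℤ}
    (hmem : ((condE P).1, f) ∈ P) (hlow : ∀ s ∈ P, s.2 < f → s ∈ S)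
    (hbd : ∀ x, N ≤ x → (x, f) ∉ S) : ((⊤ : WithTop ℤ), (f : WithTop ℤ)) ∈ ISet P := by
  have key : ∀ b ∈ Gam P, ∀ c ∈ Gam P, ((⊤ : WithTop ℤ), (f : WithTop ℤ)) = b + c →
      b.1 = ⊤ → ((⊤ : WithTop ℤ), (f : WithTop ℤ)) = b := by
    rintro ⟨b1, b2⟩ hb c hc h (rfl : b1 = ⊤)
    obtain ⟨y, y', rfl, hy', hyy⟩ := WithTop.add_eq_coe.1 (congrArg Prod.snd h).symm
    obtain ⟨x', hx'⟩ := Gam_exists_row hc hy'.symm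
    have hypos := (hP.1 (Gam_row_mem hP hb le_rfl)).2
    have hy'pos := (hP.1 hx').2
    simp only at hypos hy'pos
    rcases eq_or_lt_of_le hypos with h0 | hypos
    · have := congrArg Prod.fst (Gam_eq_zero_of_snd hP hl hb (by rw [h0]))
      exact absurd this WithTop.top_ne_zero
    rcases eq_or_lt_of_le hy'pos with h0 | hy'pos
    · rw [Gam_eq_zero_of_snd hP hl hc (by rw [← hy', h0]), add_zero] at h
      exact h
    exfalso
    have h1 := hadd _ (hlow _ (Gam_row_mem hP hb
        (x := max (condE P).1 (N - x')) (le_max_left _ _)) (by show y < f; omega))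
      _ (hlow _ hx' (by show y' < f; omega))
    rw [Prod.mk_add_mk, hyy] at h1
    exact hbd _ (by omega) h1
  refine ⟨Or.inr (Or.inr ⟨f, rfl, hmem⟩), fun h => ?_, fun b hb c hc h => ?_⟩
  · exact absurd (congrArg Prod.fst h) WithTop.top_ne_zero
  · rcases WithTop.add_eq_top.1 (congrArg Prod.fst h).symm with h' | h'
    · exact Or.inl (key b hb c hc h h')
    · exact Or.inr (key c hc b hb (h.trans (add_comm b c)) h')

lemma mem_of_iotaZ_mem_Gam {S : Set Z2} {w : Om} (hw : w ∈ Gam S) {x y : ℤ} (h1 : w.1 = x)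
    (h2 : w.2 = y) : (x, y) ∈ S := by
  rcases hw with ⟨s, hs, rfl⟩ | ⟨a, rfl, ha⟩ | ⟨b, rfl, hb⟩
  · have : s = (x, y) := Prod.ext (WithTop.coe_injective h1) (WithTop.coe_injective h2)
    exact this ▸ hs
  · exact absurd h2.symm WithTop.coe_ne_top
  · exact absurd h1.symm WithTop.coe_ne_top

lemma mem_ISet_of_notMem {S P : Set Z2} (h0 : (0 : Z2) ∈ S)
    (hadd : ∀ a ∈ S, ∀ b ∈ S, a + b ∈ S)
    (hnew : ∀ t ∈ P, t ∉ S → ∀ s ∈ P, s ≠ 0 → t + s ∈ S) {t : Z2} (ht : t ∈ P) (ht' : t ∉ S) :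
    iotaZ t ∈ ISet P := by
  refine ⟨Or.inl ⟨t, ht, rfl⟩, fun h => ht' ?_, fun b hb c hc h => ?_⟩
  · have : t = 0 := Prod.ext (WithTop.coe_injective (congrArg Prod.fst h))
      (WithTop.coe_injective (congrArg Prod.snd h))
    exact this ▸ h0
  · obtain ⟨x, x', hx, hx', hxx⟩ := WithTop.add_eq_coe.1 (congrArg Prod.fst h).symm
    obtain ⟨y, y', hy, hy', hyy⟩ := WithTop.add_eq_coe.1 (congrArg Prod.snd h).symm
    have hbP := mem_of_iotaZ_mem_Gam hb hx.symm hy.symm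
    have hcP := mem_of_iotaZ_mem_Gam hc hx'.symm hy'.symm
    have hsum : ((x, y) : Z2) + (x', y') = t := Prod.ext hxx hyy
    have hb' : iotaZ (x, y) = b := Prod.ext hx hy
    have hc' : iotaZ (x', y') = c := Prod.ext hx' hy'
    by_cases hbS : (x, y) ∈ S
    · by_cases hcS : (x', y') ∈ S
      · exact absurd (hsum ▸ hadd _ hbS _ hcS) ht'
      · by_cases hz : ((x, y) : Z2) = 0
        · right; rw [← hc', ← hsum, hz, zero_add]
        · exact absurd (hsum ▸ add_comm (x', y') (x, y) ▸ hnew _ hcP hcS _ hbP hz) ht'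
    · by_cases hz : ((x', y') : Z2) = 0
      · left; rw [← hb', ← hsum, hz, add_zero]
      · exact absurd (hsum ▸ hnew _ hbP hbS _ hcP hz) ht'

lemma minClosed_union {S T : Set Z2} (hS : MinClosed S)
    (hTS : ∀ a ∈ T, ∀ b ∈ S, a ⊓ b ∈ S ∪ T) (hT : ∀ a ∈ T, ∀ b ∈ T, a ⊓ b ∈ S ∪ T) :
    MinClosed (S ∪ T) := by
  rintro a (ha | ha) b (hb | hb)
  · exact Or.inl (hS a ha b hb)
  · exact inf_comm a b ▸ hTS b hb a ha
  · exact hTS a ha b hb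
  · exact hT a ha b hb

lemma add_mem_union {S T : Set Z2} (hadd : ∀ a ∈ S, ∀ b ∈ S, a + b ∈ S)
    (hnew : ∀ t ∈ T, ∀ s ∈ S ∪ T, s ≠ 0 → t + s ∈ S) :
    ∀ a ∈ S ∪ T, ∀ b ∈ S ∪ T, a + b ∈ S ∪ T := by
  rintro a (ha | ha) b (hb | hb)
  · exact Or.inl (hadd a ha b hb)
  · by_cases h : a = 0
    · rw [h, zero_add]; exact Or.inr hb
    · rw [add_comm]; exact Or.inl (hnew b hb a (Or.inl ha) h)
  · by_cases h : b = 0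
    · rw [h, add_zero]; exact Or.inr ha
    · exact Or.inl (hnew a ha b (Or.inl hb) h)
  · by_cases h : b = 0
    · rw [h, add_zero]; exact Or.inr ha
    · exact Or.inl (hnew a ha b (Or.inr hb) h)

lemma IsLocal.pos {S : Set Z2} (hS : IsGood S) (hl : IsLocal S) {s : Z2} (hs : s ∈ S)
    (h : s ≠ 0) : 1 ≤ s.1 ∧ 1 ≤ s.2 := by
  have hO := hS.1 hs
  simp only [orth, Set.mem_ofPred_eq] at hO
  have h1 : s.1 ≠ 0 := fun h' => h (hl s hs (Or.inl h'))
  have h2 : s.2 ≠ 0 := fun h' => h (hl s hs (Or.inr h'))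
  omega

lemma one_le_condE {S : Set Z2} (hS : IsGood S) (hl : IsLocal S) :
    1 ≤ (condE S).1 ∧ 1 ≤ (condE S).2 := by
  refine hl.pos hS (mem_of_condE_le hS le_rfl) fun h => ?_
  have h1 : ((0, 1) : Z2) ∈ S := mem_of_condE_le hS (by rw [h]; exact ⟨le_rfl, by simp⟩)
  have := hl _ h1 (Or.inl rfl)
  simp at this

lemma col_notMem_of_condE {S : Set Z2} (hS : IsGood S) {y : ℤ} (hy : (condE S).2 ≤ y) :
    ((condE S).1 - 1, y) ∉ S := by
  intro hm
  have hδ : ∀ y : Z2, ((condE S).1, (condE S).2) ≤ y → y ∈ S := fun y hy => mem_of_condE_le hS hy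
  have : condE S ≤ ((condE S).1 - 1, (condE S).2) := by
    refine condE_le hS fun z hz => ?_
    have h1 : (condE S).1 - 1 ≤ z.1 := hz.1
    have h2 : (condE S).2 ≤ z.2 := hz.2
    rcases eq_or_lt_of_le h1 with h | h
    · have := hS.col_mem hδ hm hy h2
      rw [h] at this
      exact this
    · exact hδ z ⟨by show (condE S).1 ≤ z.1; omega, h2⟩
  have h1 : (condE S).1 ≤ (condE S).1 - 1 := this.1
  omega

lemma row_notMem_of_condE {S : Set Z2} (hS : IsGood S) {x : ℤ} (hx : (condE S).1 ≤ x) :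
    (x, (condE S).2 - 1) ∉ S := by
  intro hm
  have hδ : ∀ y : Z2, ((condE S).1, (condE S).2) ≤ y → y ∈ S := fun y hy => mem_of_condE_le hS hy
  have : condE S ≤ ((condE S).1, (condE S).2 - 1) := by
    refine condE_le hS fun z hz => ?_
    have h1 : (condE S).1 ≤ z.1 := hz.1
    have h2 : (condE S).2 - 1 ≤ z.2 := hz.2
    rcases eq_or_lt_of_le h2 with h | h
    · have := hS.row_mem hδ hm hx h1
      rw [h] at this
      exact this
    · exact hδ z ⟨h1, by show (condE S).2 ≤ z.2; omega⟩
  have h1 : (condE S).2 ≤ (condE S).2 - 1 := this.2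
  omega

/-! ### Existence of a special parent -/

/-- The points added to `S` to make its column `f` infinite. -/
def colNew (S : Set Z2) (f : ℤ) : Set Z2 :=
  {a | a.1 = f ∧ (f + 1, a.2) ∈ S ∧ ∀ z, (f, z) ∈ S → z < a.2}

/-- The points added to `S` on the row of the top element of its column `f`. -/
def rowNew (S : Set Z2) (f : ℤ) : Set Z2 :=
  {a | f < a.1 ∧ (f, a.2) ∈ S ∧ ∀ z, (f, z) ∈ S → z ≤ a.2}

section ColumnExtension

variable {S : Set Z2} {f c : ℤ}

lemma minClosed_colExt (hS : IsGood S) (hδ : ∀ y : Z2, (f + 1, c) ≤ y → y ∈ S) :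
    MinClosed (S ∪ (colNew S f ∪ rowNew S f)) := by
  have hmin := hS.2.2.2.1
  refine minClosed_union hmin ?_ ?_
  · rintro ⟨a1, a2⟩ (⟨h1, h2, h3⟩ | ⟨h1, h2, h3⟩) ⟨b1, b2⟩ hb <;> simp only at h1 h2 h3
    · subst h1
      rcases lt_or_ge b1 a1 with hlt | hge
      · left
        have := hmin _ h2 _ hb
        rwa [show ((a1 + 1, a2) : Z2) ⊓ (b1, b2) = (a1, a2) ⊓ (b1, b2) from
          Prod.ext (by show min (a1 + 1) b1 = min a1 b1; omega) rfl] at this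
      rcases le_or_gt a2 b2 with hle | hlt
      · right; left
        rw [inf_eq_left.2 (show ((a1, a2) : Z2) ≤ (b1, b2) from ⟨hge, hle⟩)]
        exact ⟨rfl, h2, h3⟩
      rw [show ((a1, a2) : Z2) ⊓ (b1, b2) = (a1, b2) from
        Prod.ext (min_eq_left hge) (min_eq_right hlt.le)]
      by_cases hz : ∃ z, (a1, z) ∈ S ∧ b2 ≤ z
      · obtain ⟨z, hz, hle⟩ := hz
        left
        have := hmin _ hb _ hz
        rwa [show ((b1, b2) : Z2) ⊓ (a1, z) = (a1, b2) from
          Prod.ext (min_eq_right hge) (min_eq_left hle)] at this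
      · push Not at hz
        have hne : b1 ≠ a1 := fun h => (hz b2 (h ▸ hb)).false
        exact Or.inr (Or.inl ⟨rfl, hS.row_mem hδ hb (by omega) le_rfl, hz⟩)
    · rcases le_or_gt b1 f with hle | hgt
      · left
        have := hmin _ h2 _ hb
        rwa [show ((f, a2) : Z2) ⊓ (b1, b2) = (a1, a2) ⊓ (b1, b2) from
          Prod.ext (by show min f b1 = min a1 b1; omega) rfl] at this
      rcases lt_or_ge b2 a2 with hlt | hge
      · left
        rw [show ((a1, a2) : Z2) ⊓ (b1, b2) = (min a1 b1, b2) from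
          Prod.ext rfl (min_eq_right hlt.le)]
        exact hS.row_mem hδ hb (by omega) (by omega)
      · right; right
        rw [show ((a1, a2) : Z2) ⊓ (b1, b2) = (min a1 b1, a2) from
          Prod.ext rfl (min_eq_left hge)]
        exact ⟨lt_min h1 hgt, h2, h3⟩
  · rintro ⟨a1, a2⟩ (⟨h1, h2, h3⟩ | ⟨h1, h2, h3⟩) ⟨b1, b2⟩ (⟨k1, k2, k3⟩ | ⟨k1, k2, k3⟩) <;>
      simp only at h1 h2 h3 k1 k2 k3
    · subst h1 k1
      rcases le_total a2 b2 with h | h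
      · rw [inf_eq_left.2 (show ((b1, a2) : Z2) ≤ (b1, b2) from ⟨le_rfl, h⟩)]
        exact Or.inr (Or.inl ⟨rfl, h2, h3⟩)
      · rw [inf_eq_right.2 (show ((b1, b2) : Z2) ≤ (b1, a2) from ⟨le_rfl, h⟩)]
        exact Or.inr (Or.inl ⟨rfl, k2, k3⟩)
    · subst h1
      rw [show ((a1, a2) : Z2) ⊓ (b1, b2) = (a1, b2) from
        Prod.ext (min_eq_left k1.le) (min_eq_right (h3 _ k2).le)]
      exact Or.inl k2
    · subst k1
      rw [show ((a1, a2) : Z2) ⊓ (b1, b2) = (b1, a2) from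
        Prod.ext (min_eq_right h1.le) (min_eq_left (k3 _ h2).le)]
      exact Or.inl h2
    · obtain rfl : a2 = b2 := le_antisymm (k3 _ h2) (h3 _ k2)
      rw [show ((a1, a2) : Z2) ⊓ (b1, a2) = (min a1 b1, a2) from
        Prod.ext rfl (min_self _)]
      exact Or.inr (Or.inr ⟨lt_min h1 k1, h2, h3⟩)

lemma g3P_colExt (hS : IsGood S) (hδ : ∀ y : Z2, (f + 1, c) ≤ y → y ∈ S)
    (hcol : ∀ y, c ≤ y → (f, y) ∉ S) : G3P (S ∪ (colNew S f ∪ rowNew S f)) := by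
  have h3 := hS.2.2.2.2.2
  refine g3P_of_lt ?_ ?_
  · rintro ⟨a1, a2⟩ ha ⟨b1, b2⟩ hb (rfl : a1 = b1) hlt
    rcases lt_trichotomy a1 f with hf | rfl | hf
    · have hold : ∀ y, (a1, y) ∈ S ∪ (colNew S f ∪ rowNew S f) → (a1, y) ∈ S := by
        rintro y (h | ⟨h, -⟩ | ⟨h, -⟩)
        · exact h
        · exact absurd h hf.ne
        · exact absurd h hf.not_gt
      obtain ⟨e, he, h⟩ := IsStaircase.exists_right_of_lt h3 (hold _ ha) (hold _ hb) rfl hlt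
      exact ⟨e, Or.inl he, h⟩
    · rcases ha with ha | ⟨-, ha, -⟩ | ⟨h, -⟩
      · by_cases hz : ∃ z, (a1, z) ∈ S ∧ a2 < z
        · obtain ⟨z, hz, hlt⟩ := hz
          obtain ⟨e, he, h⟩ := IsStaircase.exists_right_of_lt h3 ha hz rfl hlt
          exact ⟨e, Or.inl he, h⟩
        · push Not at hz
          exact ⟨(a1 + 1, a2), Or.inr (Or.inr ⟨by simp, ha, hz⟩), by simp, rfl⟩
      · exact ⟨(a1 + 1, a2), Or.inl ha, by simp, rfl⟩
      · exact absurd h (lt_irrefl _)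
    · refine ⟨(a1 + 1, a2), ?_, by simp, rfl⟩
      rcases ha with ha | ⟨h, -⟩ | ⟨-, h⟩
      · exact Or.inl (hS.row_mem hδ ha (by omega) (by omega))
      · exact absurd h hf.ne'
      · exact Or.inr (Or.inr ⟨by show f < a1 + 1; omega, h⟩)
  · rintro ⟨a1, a2⟩ ha ⟨b1, b2⟩ hb (rfl : a2 = b2) hlt
    rcases lt_trichotomy a1 f with hf | rfl | hf
    · have ha' : (a1, a2) ∈ S := by
        rcases ha with h | ⟨h, -⟩ | ⟨h, -⟩
        · exact h
        · exact absurd h hf.ne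
        · exact absurd h hf.not_gt
      obtain ⟨x, hx, hxm⟩ : ∃ x, a1 < x ∧ (x, a2) ∈ S := by
        rcases hb with h | ⟨-, h, -⟩ | ⟨-, h, -⟩
        exacts [⟨b1, hlt, h⟩, ⟨f + 1, by omega, h⟩, ⟨f, hf, h⟩]
      obtain ⟨e, he, h⟩ := IsStaircase.exists_up_of_lt h3 ha' hxm rfl hx
      exact ⟨e, Or.inl he, h⟩
    · refine ⟨(a1, max c (a2 + 1)), Or.inr (Or.inl ⟨rfl, hδ _ ⟨le_rfl, le_max_left _ _⟩,
        fun z hz => ?_⟩), by show a2 < max c (a2 + 1); omega, rfl⟩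
      have : ¬ c ≤ z := fun h => hcol z h hz
      show z < max c (a2 + 1)
      omega
    · exact ⟨(a1, max c (a2 + 1)), Or.inl (hδ _ ⟨by show f + 1 ≤ a1; omega, le_max_left _ _⟩),
        by show a2 < max c (a2 + 1); omega, rfl⟩

lemma exists_row_mem_of_new {a : Z2} (ha : a ∈ colNew S f ∪ rowNew S f) :
    f ≤ a.1 ∧ ∃ x, f ≤ x ∧ (x, a.2) ∈ S := by
  rcases ha with ⟨h1, h2, -⟩ | ⟨h1, h2, -⟩
  · exact ⟨h1.ge, f + 1, by omega, h2⟩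
  · exact ⟨h1.le, f, le_rfl, h2⟩

lemma add_new_mem (hS : IsGood S) (hl : IsLocal S) (hδ : ∀ y : Z2, (f + 1, c) ≤ y → y ∈ S)
    (hf : 1 ≤ f) : ∀ t ∈ colNew S f ∪ rowNew S f, ∀ s ∈ S ∪ (colNew S f ∪ rowNew S f),
      s ≠ 0 → t + s ∈ S := by
  intro t ht s hs hs0
  obtain ⟨h1, x, hx, hm⟩ := exists_row_mem_of_new ht
  obtain ⟨h1', x', hx', hm'⟩ : 1 ≤ s.1 ∧ ∃ x', 1 ≤ x' ∧ (x', s.2) ∈ S := by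
    rcases hs with hs | hs
    · exact ⟨(hl.pos hS hs hs0).1, s.1, (hl.pos hS hs hs0).1, hs⟩
    · obtain ⟨h, x', hx', hm'⟩ := exists_row_mem_of_new hs
      exact ⟨by omega, x', by omega, hm'⟩
  exact hS.row_mem hδ (hS.2.2.1 _ hm _ hm') (by show f + 1 ≤ x + x'; omega)
    (by show f + 1 ≤ t.1 + s.1; omega)

lemma new_pos (hS : IsGood S) (hl : IsLocal S) (hf : 1 ≤ f) {a : Z2}
    (ha : a ∈ colNew S f ∪ rowNew S f) : 1 ≤ a.1 ∧ 1 ≤ a.2 := by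
  obtain ⟨h1, x, hx, hm⟩ := exists_row_mem_of_new ha
  refine ⟨by omega, (hl.pos hS hm fun h => ?_).2⟩
  have : x = 0 := congrArg Prod.fst h
  omega

lemma isGood_colExt (hS : IsGood S) (hl : IsLocal S) (hδ : ∀ y : Z2, (f + 1, c) ≤ y → y ∈ S)
    (hcol : ∀ y, c ≤ y → (f, y) ∉ S) (hf : 1 ≤ f) :
    IsGood (S ∪ (colNew S f ∪ rowNew S f)) := by
  refine ⟨Set.union_subset hS.1 fun a ha => ?_, Or.inl hS.2.1,
    add_mem_union hS.2.2.1 (add_new_mem hS hl hδ hf), minClosed_colExt hS hδ,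
    ⟨_, fun y hy => Or.inl (hδ y hy)⟩, g3P_colExt hS hδ hcol⟩
  have := new_pos hS hl hf ha
  exact ⟨by omega, by omega⟩

lemma isLocal_colExt (hS : IsGood S) (hl : IsLocal S) (hf : 1 ≤ f) :
    IsLocal (S ∪ (colNew S f ∪ rowNew S f)) := by
  rintro a (ha | ha) h
  · exact hl a ha h
  · have := new_pos hS hl hf ha
    omega

lemma new_notMem (hS : IsGood S) {a : Z2} (ha : a ∈ colNew S f ∪ rowNew S f) : a ∉ S := by
  rcases ha with ⟨h1, -, h3⟩ | ⟨h1, h2, h3⟩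
  · exact fun hm => (h3 a.2 (h1 ▸ hm)).false
  · intro hm
    obtain ⟨e, he, hlt, heq⟩ := IsStaircase.exists_up_of_lt hS.2.2.2.2.2 h2 hm rfl h1
    have heq' : e.1 = f := heq
    exact (h3 e.2 (by rw [← heq']; exact he)).not_gt hlt

theorem exists_specialParent_colExt (hS : IsGood S) (hl : IsLocal S)
    (hδ : ∀ y : Z2, (f + 1, c) ≤ y → y ∈ S) (hcol : ∀ y, c ≤ y → (f, y) ∉ S) (hf : 1 ≤ f) :
    SpecialParent (S ∪ (colNew S f ∪ rowNew S f)) S := by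
  set P := S ∪ (colNew S f ∪ rowNew S f) with hPdef
  have hP : IsGood P := isGood_colExt hS hl hδ hcol hf
  have hPl : IsLocal P := isLocal_colExt hS hl hf
  have hnew : ∀ t ∈ P, t ∉ S → iotaZ t ∈ ISet P := fun t ht ht' =>
    mem_ISet_of_notMem hS.2.1 hS.2.2.1
      (fun t ht ht' => add_new_mem hS hl hδ hf t (ht.resolve_left ht')) ht ht'
  have hcolP : ∀ y, c ≤ y → (f, y) ∈ colNew S f := fun y hy =>
    ⟨rfl, hδ _ ⟨le_rfl, hy⟩, fun z hz => lt_of_not_ge fun h => hcol z (hy.trans h) hz⟩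
  have hcondP : condE P ≤ (f, c) := by
    refine condE_le hP fun y hy => ?_
    rcases eq_or_lt_of_le (show f ≤ y.1 from hy.1) with h | h
    · have := hcolP y.2 hy.2
      rw [show ((f, y.2) : Z2) = y from Prod.ext h rfl] at this
      exact Or.inr (Or.inl this)
    · exact Or.inl (hδ y ⟨by show f + 1 ≤ y.1; omega, hy.2⟩)
  have hδP : ∀ y : Z2, ((condE P).1, (condE P).2) ≤ y → y ∈ P := fun y hy =>
    mem_of_condE_le hP hy
  have hcm : (f, (condE P).2) ∈ P :=
    hP.col_mem hδP (Or.inr (Or.inl (hcolP c le_rfl))) hcondP.2 le_rfl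
  have hα : ((f : WithTop ℤ), (⊤ : WithTop ℤ)) ∈ IA P := by
    refine ⟨infinite_col_mem_ISet hP hPl hS.2.2.1 hcm ?_ hcol, Or.inr (Or.inl ⟨f, rfl, hcm⟩)⟩
    rintro s (hs | hs) hlt
    · exact hs
    · have := (exists_row_mem_of_new hs).1
      omega
  refine ⟨hP, hPl, P \ S, ⟨?_, (f, c), ⟨Or.inr (Or.inl (hcolP c le_rfl)), hcol c le_rfl⟩,
    Or.inr (Or.inl (hcolP c le_rfl)), hcondP⟩, ?_⟩
  swap
  · rw [Set.sdiff_sdiff_right_self]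
    exact (Set.inter_eq_right.2 Set.subset_union_left).symm
  by_cases hne : ∃ z, (f, z) ∈ S
  · obtain ⟨t, ht, hmax⟩ := Int.exists_greatest_of_bdd (P := fun z => (f, z) ∈ S)
      ⟨c, fun z hz => (lt_of_not_ge fun h => hcol z h hz).le⟩ hne
    have hrow : ∀ x, f < x → (x, t) ∈ rowNew S f := fun x hx => ⟨hx, ht, hmax⟩
    have hdiff : P \ S = P ∩ upD ((f : WithTop ℤ), (t : WithTop ℤ)) := by
      ext s
      constructor
      · rintro ⟨hs, hs'⟩
        refine ⟨hs, ?_⟩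
        rcases hs.resolve_left hs' with ⟨h1, -, h3⟩ | ⟨h1, h2, h3⟩
        · exact Or.inl ⟨by rw [h1], WithTop.coe_lt_coe.2 (h3 t ht)⟩
        · exact Or.inr ⟨by rw [le_antisymm (hmax _ h2) (h3 _ ht)], WithTop.coe_lt_coe.2 h1⟩
      · rintro ⟨hs, ⟨h1, h2⟩ | ⟨h1, h2⟩⟩
        · have h1' : s.1 = f := WithTop.coe_injective h1
          have h2' : t < s.2 := WithTop.coe_lt_coe.1 h2
          exact ⟨hs, fun h => (hmax s.2 (h1' ▸ h)).not_gt h2'⟩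
        · have h1' : s.2 = t := WithTop.coe_injective h1
          have h2' : f < s.1 := WithTop.coe_lt_coe.1 h2
          exact ⟨hs, new_notMem hS (Or.inr (by
            have := hrow s.1 h2'
            rwa [← h1'] at this))⟩
    have hrm : ((condE P).1, t) ∈ P :=
      hP.row_mem hδP (z := f + 1) (Or.inr (Or.inr (hrow (f + 1) (by omega))))
        (by have : (condE P).1 ≤ f := hcondP.1
            omega) le_rfl
    have hβ : ((⊤ : WithTop ℤ), (t : WithTop ℤ)) ∈ IA P := by
      refine ⟨infinite_row_mem_ISet (N := f + 1) hP hPl hS.2.2.1 hrm ?_ fun x hx =>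
        new_notMem hS (Or.inr (hrow x (by omega))), Or.inr (Or.inr ⟨t, rfl, hrm⟩)⟩
      rintro s (hs | ⟨-, -, h3⟩ | ⟨-, -, h3⟩) hlt
      · exact hs
      · exact absurd (h3 t ht) hlt.not_gt
      · exact absurd (h3 t ht) hlt.not_ge
    have hinf : (((f : WithTop ℤ), ⊤) : Om) ⊓ (⊤, (t : WithTop ℤ)) =
        ((f : WithTop ℤ), (t : WithTop ℤ)) := Prod.ext (min_eq_left le_top) (min_eq_right le_top)
    refine ⟨2, fun i => if i = 0 then ((f : WithTop ℤ), ⊤) else (⊤, (t : WithTop ℤ)),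
      ⟨by omega, ?_, ?_, ?_, ?_, ?_⟩, ?_⟩
    · intro i _
      dsimp only
      split_ifs
      exacts [hα, hβ]
    · intro i j hij hj
      obtain rfl : i = 0 := by omega
      obtain rfl : j = 1 := by omega
      simp
    · intro s _ h
      simp [lowD2] at h
    · intro s _ h
      simp [lowD1] at h
    · intro i hi
      obtain rfl : i = 0 := by omega
      refine ⟨by simp, by simp, fun s hs hsu => ?_⟩
      simp only [if_true, zero_add, one_ne_zero, if_false, hinf] at hsu
      have : s ∈ P \ S := hdiff ▸ ⟨hs, hsu⟩
      exact hnew s this.1 this.2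
    · rw [hdiff]
      ext s
      simp [trackSet, hinf, finPart, iotaZ, lowD1, lowD2]
  · push Not at hne
    have hdiff : ∀ s ∈ P, s ∉ S ↔ s.1 = f := by
      intro s hs
      constructor
      · intro hs'
        rcases hs.resolve_left hs' with ⟨h1, -⟩ | ⟨-, h2, -⟩
        · exact h1
        · exact absurd h2 (hne _)
      · exact fun h1 h => hne s.2 (h1 ▸ h)
    refine ⟨1, fun _ => ((f : WithTop ℤ), ⊤), ⟨le_rfl, fun _ _ => hα, by omega, ?_, ?_,
      by omega⟩, ?_⟩
    · intro s _ h
      simp [lowD2] at h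
    · rintro s hs ⟨h, -⟩
      exact hnew s hs ((hdiff s hs).2 (WithTop.coe_injective h))
    · ext s
      simp only [trackSet, finPart, iotaZ, lowD1, lowD2]
      simp
      exact fun hs => hdiff s hs

end ColumnExtension

/-- The points added to `S` to fill the empty row `f` when the conductor has abscissa `1`. -/
def fullRow (f : ℤ) : Set Z2 := {a | 1 ≤ a.1 ∧ a.2 = f}

section RowExtension

variable {S : Set Z2} {f : ℤ}

lemma add_fullRow_mem (hS : IsGood S) (hl : IsLocal S) (hδ : ∀ y : Z2, (1, f + 1) ≤ y → y ∈ S)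
    (hf : 1 ≤ f) : ∀ t ∈ fullRow f, ∀ s ∈ S ∪ fullRow f, s ≠ 0 → t + s ∈ S := by
  rintro t ⟨h1, h2⟩ s hs hs0
  have : 1 ≤ s.1 ∧ 1 ≤ s.2 := by
    rcases hs with hs | ⟨k1, k2⟩
    · exact hl.pos hS hs hs0
    · omega
  exact hδ _ ⟨by show 1 ≤ t.1 + s.1; omega, by show f + 1 ≤ t.2 + s.2; omega⟩

lemma isGood_rowExt (hS : IsGood S) (hl : IsLocal S) (hδ : ∀ y : Z2, (1, f + 1) ≤ y → y ∈ S)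
    (hf : 1 ≤ f) : IsGood (S ∪ fullRow f) := by
  have hzero : ∀ s ∈ S ∪ fullRow f, s = 0 ∨ 1 ≤ s.1 ∧ 1 ≤ s.2 := by
    rintro s (hs | ⟨k1, k2⟩)
    · by_cases h : s = 0
      · exact Or.inl h
      · exact Or.inr (hl.pos hS hs h)
    · omega
  have hrow : ∀ x x' y, (x, y) ∈ S ∪ fullRow f → 1 ≤ x → 1 ≤ x' → (x', y) ∈ S ∪ fullRow f := by
    rintro x x' y (h | ⟨-, h⟩) hx hx'
    · exact Or.inl (hS.row_mem hδ h hx hx')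
    · exact Or.inr ⟨hx', h⟩
  refine ⟨?_, Or.inl hS.2.1, add_mem_union hS.2.2.1 (add_fullRow_mem hS hl hδ hf), ?_,
    ⟨_, fun y hy => Or.inl (hδ y hy)⟩, g3P_of_lt ?_ ?_⟩
  · refine Set.union_subset hS.1 ?_
    rintro a ⟨h1, h2⟩
    exact ⟨by omega, by omega⟩
  · intro a ha b hb
    rcases hzero a ha with rfl | ha'
    · rw [inf_eq_left.2]
      · exact ha
      · rcases hzero b hb with rfl | hb'
        · exact le_rfl
        · exact ⟨by show 0 ≤ b.1; omega, by show 0 ≤ b.2; omega⟩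
    rcases hzero b hb with rfl | hb'
    · rw [inf_eq_right.2]
      · exact hb
      · exact ⟨by show 0 ≤ a.1; omega, by show 0 ≤ a.2; omega⟩
    have hx : 1 ≤ min a.1 b.1 := le_min ha'.1 hb'.1
    rcases min_choice a.2 b.2 with h | h
    · rw [show a ⊓ b = (min a.1 b.1, a.2) from Prod.ext rfl h]
      exact hrow _ _ _ ha ha'.1 hx
    · rw [show a ⊓ b = (min a.1 b.1, b.2) from Prod.ext rfl h]
      exact hrow _ _ _ hb hb'.1 hx
  · intro a ha b hb h1 h2
    rcases hzero a ha with rfl | ha'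
    · rcases hzero b hb with rfl | hb'
      · exact absurd h2 (lt_irrefl _)
      · have : (0 : ℤ) = b.1 := h1
        omega
    · exact ⟨(a.1 + 1, a.2), hrow _ _ _ ha ha'.1 (by omega), by simp, rfl⟩
  · intro a ha b hb h1 h2
    rcases hzero a ha with rfl | ha'
    · rcases hzero b hb with rfl | hb'
      · exact absurd h2 (lt_irrefl _)
      · have : (0 : ℤ) = b.2 := h1
        omega
    · exact ⟨(a.1, max (f + 1) (a.2 + 1)), Or.inl (hδ _ ⟨ha'.1, le_max_left _ _⟩),
        by show a.2 < max (f + 1) (a.2 + 1); omega, rfl⟩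

theorem exists_specialParent_rowExt (hS : IsGood S) (hl : IsLocal S)
    (hδ : ∀ y : Z2, (1, f + 1) ≤ y → y ∈ S) (hrow : ∀ x, 1 ≤ x → (x, f) ∉ S) (hf : 1 ≤ f) :
    SpecialParent (S ∪ fullRow f) S := by
  set P := S ∪ fullRow f with hPdef
  have hP : IsGood P := isGood_rowExt hS hl hδ hf
  have hPl : IsLocal P := by
    rintro a (ha | ⟨h1, h2⟩) h
    · exact hl a ha h
    · omega
  have hnew : ∀ t ∈ P, t ∉ S → iotaZ t ∈ ISet P := fun t ht ht' =>
    mem_ISet_of_notMem hS.2.1 hS.2.2.1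
      (fun t ht ht' => add_fullRow_mem hS hl hδ hf t (ht.resolve_left ht')) ht ht'
  have hrowP : ∀ x, 1 ≤ x → (x, f) ∈ P := fun x hx => Or.inr ⟨hx, rfl⟩
  have hcondP : condE P ≤ (1, f) := by
    refine condE_le hP fun y hy => ?_
    rcases eq_or_lt_of_le (show f ≤ y.2 from hy.2) with h | h
    · exact Or.inr ⟨hy.1, h.symm⟩
    · exact Or.inl (hδ y ⟨hy.1, by show f + 1 ≤ y.2; omega⟩)
  have hδP : ∀ y : Z2, ((condE P).1, (condE P).2) ≤ y → y ∈ P := fun y hy =>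
    mem_of_condE_le hP hy
  have hrm : ((condE P).1, f) ∈ P := hP.row_mem hδP (hrowP 1 le_rfl) hcondP.1 le_rfl
  have hα : ((⊤ : WithTop ℤ), (f : WithTop ℤ)) ∈ IA P := by
    refine ⟨infinite_row_mem_ISet hP hPl hS.2.2.1 hrm ?_ hrow, Or.inr (Or.inr ⟨f, rfl, hrm⟩)⟩
    rintro s (hs | ⟨-, hs⟩) hlt
    · exact hs
    · omega
  have hdiff : ∀ s ∈ P, s ∉ S ↔ s.2 = f := by
    intro s hs
    refine ⟨fun hs' => (hs.resolve_left hs').2, fun h hm => ?_⟩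
    refine hrow s.1 (hl.pos hS hm ?_).1 (h ▸ hm)
    rintro rfl
    have : (0 : ℤ) = f := h
    omega
  refine ⟨hP, hPl, P \ S, ⟨?_, (1, f), ⟨hrowP 1 le_rfl, hrow 1 le_rfl⟩, hrowP 1 le_rfl, hcondP⟩,
    ?_⟩
  swap
  · rw [Set.sdiff_sdiff_right_self]
    exact (Set.inter_eq_right.2 Set.subset_union_left).symm
  refine ⟨1, fun _ => (⊤, (f : WithTop ℤ)), ⟨le_rfl, fun _ _ => hα, by omega, ?_, ?_,
    by omega⟩, ?_⟩
  · rintro s hs ⟨h, -⟩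
    exact hnew s hs ((hdiff s hs).2 (WithTop.coe_injective h))
  · intro s _ h
    simp [lowD1] at h
  · ext s
    simp only [trackSet, finPart, iotaZ, lowD1, lowD2]
    simp
    exact fun hs => hdiff s hs

end RowExtension

theorem exists_specialParent {S : Set Z2} (hS : IsGood S) (hl : IsLocal S) (hne : S ≠ N2oneone) :
    ∃ P, SpecialParent P S := by
  have hδ : ∀ y : Z2, ((condE S).1, (condE S).2) ≤ y → y ∈ S := fun y hy => mem_of_condE_le hS hy
  have hpos := one_le_condE hS hl
  have hcol := fun y => col_notMem_of_condE hS (y := y)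
  have hrow := fun x => row_notMem_of_condE hS (x := x)
  generalize (condE S).1 = c₁ at *
  generalize (condE S).2 = c₂ at *
  rcases eq_or_lt_of_le hpos.1 with rfl | h1
  · rcases eq_or_lt_of_le hpos.2 with rfl | h2
    · refine absurd (Set.Subset.antisymm (fun s hs => ?_) ?_) hne
      · by_cases h : s = 0
        · exact Or.inl h
        · exact Or.inr (hl.pos hS hs h)
      · rintro s (rfl | hs)
        exacts [hS.2.1, hδ s hs]
    · exact ⟨_, exists_specialParent_rowExt (f := c₂ - 1) hS hl (by simpa using hδ) hrow
        (by omega)⟩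
  · exact ⟨_, exists_specialParent_colExt (f := c₁ - 1) (c := c₂) hS hl (by simpa using hδ) hcol
      (by omega)⟩

/-! ### The root of the tree -/

lemma isLocal_N2oneone : IsLocal N2oneone := by
  rintro a (rfl | ⟨h1, h2⟩) h
  · rfl
  · simp only at h1 h2
    omega

lemma isGood_N2oneone : IsGood N2oneone := by
  have key : ∀ a ∈ N2oneone, a = 0 ∨ 1 ≤ a.1 ∧ 1 ≤ a.2 := fun a ha => ha
  refine ⟨?_, Or.inl rfl, ?_, ?_, ⟨(1, 1), fun y hy => Or.inr hy⟩, g3P_of_lt ?_ ?_⟩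
  · rintro a ha
    rcases key a ha with rfl | h
    · exact ⟨le_rfl, le_rfl⟩
    · exact ⟨by omega, by omega⟩
  · intro a ha b hb
    rcases key a ha with rfl | h
    · rwa [zero_add]
    rcases key b hb with rfl | h'
    · rwa [add_zero]
    exact Or.inr ⟨by show 1 ≤ a.1 + b.1; omega, by show 1 ≤ a.2 + b.2; omega⟩
  · intro a ha b hb
    rcases key a ha with rfl | h
    · rcases key b hb with rfl | h'
      · exact Or.inl (inf_idem _)
      · exact Or.inl (inf_eq_left.2 ⟨by show 0 ≤ b.1; omega, by show 0 ≤ b.2; omega⟩)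
    rcases key b hb with rfl | h'
    · exact Or.inl (inf_eq_right.2 ⟨by show 0 ≤ a.1; omega, by show 0 ≤ a.2; omega⟩)
    exact Or.inr (le_inf h h')
  · intro a ha b hb h1 h2
    rcases key a ha with rfl | h
    · have := isLocal_N2oneone b hb (Or.inl h1.symm)
      exact absurd h2 (by rw [this]; exact lt_irrefl _)
    · exact ⟨(a.1 + 1, a.2), Or.inr ⟨by show 1 ≤ a.1 + 1; omega, h.2⟩, by simp, rfl⟩
  · intro a ha b hb h1 h2
    rcases key a ha with rfl | h
    · have := isLocal_N2oneone b hb (Or.inr h1.symm)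
      exact absurd h2 (by rw [this]; exact lt_irrefl _)
    · exact ⟨(a.1, a.2 + 1), Or.inr ⟨h.1, by show 1 ≤ a.2 + 1; omega⟩, by simp, rfl⟩

lemma genus_N2oneone : genus N2oneone = 1 := by
  have hcol : colGaps N2oneone = ∅ := by
    refine Set.eq_empty_of_forall_notMem fun x hx => ?_
    obtain ⟨h0, h⟩ := hx
    rcases eq_or_lt_of_le h0 with rfl | h1
    · exact h 0 (Or.inl rfl)
    · exact h 1 (Or.inr ⟨h1, le_rfl⟩)
  have hrow : rowGaps N2oneone = {0} := by
    refine Set.eq_singleton_iff_unique_mem.2 ⟨⟨le_rfl, 1, fun x hx hm => ?_⟩, ?_⟩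
    · have : x = 0 := congrArg Prod.fst (isLocal_N2oneone _ hm (Or.inr rfl))
      omega
    · rintro y ⟨h0, X, hX⟩
      by_contra hne
      exact hX (max X 1) (le_max_left _ _)
        (Or.inr ⟨le_max_right _ _, by show 1 ≤ y; omega⟩)
  rw [genus_eq isGood_N2oneone, hcol, hrow]
  simp

lemma one_le_genus {S : Set Z2} (hS : IsGood S) (hl : IsLocal S) : 1 ≤ genus S := by
  have h0 : (0 : ℤ) ∈ rowGaps S := by
    refine ⟨le_rfl, 1, fun x hx hm => ?_⟩
    have : x = 0 := congrArg Prod.fst (hl _ hm (Or.inr rfl))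
    omega
  have := (Set.ncard_pos hS.finite_rowGaps).2 ⟨0, h0⟩
  rw [genus_eq hS]
  omega

/-- For every `g ≥ 1`, `A_g` coincides with the set `𝔑_g`
of all local good semigroups of `ℕ²` of genus `g`. -/
theorem Alevel_eq_genus_level (g : ℕ) (hg : 1 ≤ g) :
    Alevel g = {S : Set Z2 | IsGood S ∧ IsLocal S ∧ genus S = (g : ℤ)} := by
  induction g, hg using Nat.le_induction with
  | base =>
    refine Set.Subset.antisymm ?_ ?_
    · rintro _ rfl
      exact ⟨isGood_N2oneone, isLocal_N2oneone, by simp [genus_N2oneone]⟩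
    · rintro S ⟨hS, hl, hg⟩
      by_contra hne
      obtain ⟨P, hP⟩ := exists_specialParent hS hl hne
      have h1 := hP.son.2.2
      have h2 := one_le_genus hP.1 hP.2.1
      push_cast at hg
      omega
  | succ n hn ih =>
    obtain ⟨m, rfl⟩ : ∃ m, n = m + 1 := ⟨n - 1, by omega⟩
    ext S
    constructor
    · rintro ⟨P, hPA, hP⟩
      rw [ih] at hPA
      obtain ⟨hS, hl, h⟩ := hP.son
      exact ⟨hS, hl, by rw [h, hPA.2.2]; push_cast; ring⟩
    · rintro ⟨hS, hl, hg⟩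
      have hne : S ≠ N2oneone := by
        rintro rfl
        rw [genus_N2oneone] at hg
        push_cast at hg
        omega
      obtain ⟨P, hP⟩ := exists_specialParent hS hl hne
      refine ⟨P, ?_, hP⟩
      rw [ih]
      have h1 := hP.son.2.2
      exact ⟨hP.1, hP.2.1, by push_cast at hg ⊢; omega⟩
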